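/- For every ranked alphabet Σ and every k ≥ 1, every tree language over Σ definable in first-order logic with k-ary deterministic transitive closure is accepted by a deterministic k-head tree-walking automaton with nested pebbles, i.e., FO+DTC^k ⊆ DPTWA^k. Moreover, the accepting automaton can be constructed so that it always halts with all heads at the root. -/

import Mathlib

namespace NestedPebbles

/-- Trees over a ranked alphabet `(Sig, rank)`: terms `σ(t₁,…,tₙ)` with `rank σ = n`. -/
inductive RTree (Sig : Type) (rank : Sig → ℕ) : Type
  | node (a : Sig) (children : Fin (rank a) → RTree Sig rank) : RTree Sig rank

namespace RTree

variable {Sig : Type} {rank : Sig → ℕ}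

/-- The label of the root symbol. -/
def label : RTree Sig rank → Sig
  | node a _ => a

/-- The `i`-th (0-based) immediate subtree, if it exists. -/
def child : RTree Sig rank → ℕ → Option (RTree Sig rank)
  | node a c, i => if h : i < rank a then some (c ⟨i, h⟩) else none

/-- The subtree at a position (a list of 0-based child indices, read from the root). -/
def subtree : RTree Sig rank → List ℕ → Option (RTree Sig rank)
  | t, [] => some t
  | t, i :: p => (t.child i).bind fun s => s.subtree p

end RTree

variable {Sig : Type} {rank : Sig → ℕ}

/-- `p` is (the address of) a node of `t`. -/
def IsPos (t : RTree Sig rank) (p : List ℕ) : Prop := (t.subtree p).isSome = true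

/-- The type of nodes of a tree `t`, as valid positions. -/
def Pos (t : RTree Sig rank) : Type := { p : List ℕ // IsPos t p }

/-- The root node. -/
def rootPos (t : RTree Sig rank) : Pos t := ⟨[], rfl⟩

/-- The label of the node of `t` at position `p`. -/
def labelAt (t : RTree Sig rank) (p : List ℕ) : Option Sig := (t.subtree p).map RTree.label

/-- The child number of a node: `0` for the root, and `j` for a `j`-th child (1-based). -/
def childNo (p : List ℕ) : ℕ :=
  match p.getLast? with
  | none => 0
  | some j => j + 1

/-!  ### First-order logic with k-ary transitive closure, on trees  -/

/-- First-order formulas over a ranked alphabet, with a `k`-ary transitive closure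
operator.  Variables are natural numbers.  `lab a x` means `x` has label `a`;
`edg i x y` means `y` is the `i`-th child of `x` (`i` is 1-based);
`le x y` means `x` is an ancestor of `y`; `tc xs ys φ us vs` is the transitive
closure `φ*` of `φ` with respect to the tuples of variables `xs`, `ys` (which it
binds), applied to the tuples of variables `us`, `vs`. -/
inductive TForm (Sig : Type) (rank : Sig → ℕ) (k : ℕ) : Type
  | lab (a : Sig) (x : ℕ)
  | edg (i : ℕ) (x y : ℕ)
  | le (x y : ℕ)
  | eq (x y : ℕ)
  | not (φ : TForm Sig rank k)
  | and (φ ψ : TForm Sig rank k)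
  | or (φ ψ : TForm Sig rank k)
  | ex (x : ℕ) (φ : TForm Sig rank k)
  | all (x : ℕ) (φ : TForm Sig rank k)
  | tc (xs ys : Fin k → ℕ) (φ : TForm Sig rank k) (us vs : Fin k → ℕ)

/-- Update a valuation on a tuple of variables simultaneously. -/
noncomputable def updVec {α : Type} {k : ℕ} (ν : ℕ → α) (xs : Fin k → ℕ) (a : Fin k → α) :
    ℕ → α :=
  fun n => if h : ∃ i, xs i = n then a h.choose else ν n

/-- Satisfaction of a formula in a tree `t` under a valuation of the variables by
nodes of `t`. -/
def Sat {k : ℕ} (t : RTree Sig rank) : TForm Sig rank k → (ℕ → Pos t) → Prop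
  | .lab a x, ν => labelAt t (ν x).1 = some a
  | .edg i x y, ν => 1 ≤ i ∧ (ν y).1 = (ν x).1 ++ [i - 1]
  | .le x y, ν => (ν x).1 <+: (ν y).1
  | .eq x y, ν => ν x = ν y
  | .not φ, ν => ¬ Sat t φ ν
  | .and φ ψ, ν => Sat t φ ν ∧ Sat t ψ ν
  | .or φ ψ, ν => Sat t φ ν ∨ Sat t ψ ν
  | .ex x φ, ν => ∃ u : Pos t, Sat t φ (Function.update ν x u)
  | .all x φ, ν => ∀ u : Pos t, Sat t φ (Function.update ν x u)
  | .tc xs ys φ us vs, ν =>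
      Relation.ReflTransGen
        (fun a b : Fin k → Pos t => Sat t φ (updVec (updVec ν xs a) ys b))
        (fun i => ν (us i)) (fun i => ν (vs i))

/-- The free variables of a formula. -/
def freeVars {k : ℕ} : TForm Sig rank k → Set ℕ
  | .lab _ x => {x}
  | .edg _ x y => {x, y}
  | .le x y => {x, y}
  | .eq x y => {x, y}
  | .not φ => freeVars φ
  | .and φ ψ => freeVars φ ∪ freeVars ψ
  | .or φ ψ => freeVars φ ∪ freeVars ψ
  | .ex x φ => freeVars φ \ {x}
  | .all x φ => freeVars φ \ {x}
  | .tc xs ys φ us vs =>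
      (freeVars φ \ (Set.range xs ∪ Set.range ys)) ∪ Set.range us ∪ Set.range vs

/-- Two `k`-tuples of variables consist of `2k` pairwise distinct variables. -/
def Distinct2 {k : ℕ} (xs ys : Fin k → ℕ) : Prop :=
  Function.Injective xs ∧ Function.Injective ys ∧ ∀ i j, xs i ≠ ys j

/-- `φ` is functional in the tuples of variables `xs`, `ys`: for every tree, every
valuation of the remaining variables, and every value of `xs`, there is at most one
value of `ys` satisfying `φ`. -/
def FunctionalIn {k : ℕ} (φ : TForm Sig rank k) (xs ys : Fin k → ℕ) : Prop :=
  ∀ (t : RTree Sig rank) (ν : ℕ → Pos t) (a b b' : Fin k → Pos t),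
    Sat t φ (updVec (updVec ν xs a) ys b) →
    Sat t φ (updVec (updVec ν xs a) ys b') → b = b'

/-- Well-formedness: in each transitive closure the `2k` bound variables are
pairwise distinct and occur free in the body. -/
def WF {k : ℕ} : TForm Sig rank k → Prop
  | .not φ => WF φ
  | .and φ ψ => WF φ ∧ WF ψ
  | .or φ ψ => WF φ ∧ WF ψ
  | .ex _ φ => WF φ
  | .all _ φ => WF φ
  | .tc xs ys φ _ _ =>
      Distinct2 xs ys ∧ (Set.range xs ∪ Set.range ys) ⊆ freeVars φ ∧ WF φ
  | _ => True

/-- All transitive closures occurring in the formula are deterministic, i.e., applied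
to functional formulas. -/
def DetTC {k : ℕ} : TForm Sig rank k → Prop
  | .not φ => DetTC φ
  | .and φ ψ => DetTC φ ∧ DetTC ψ
  | .or φ ψ => DetTC φ ∧ DetTC ψ
  | .ex _ φ => DetTC φ
  | .all _ φ => DetTC φ
  | .tc xs ys φ _ _ => FunctionalIn φ xs ys ∧ DetTC φ
  | _ => True

/-- All occurrences of transitive closure are positive (within the scope of an even
number of negations); the polarity parameter `b` is `true` for an even number. -/
def PosTC {k : ℕ} : Bool → TForm Sig rank k → Prop
  | b, .not φ => PosTC (!b) φ
  | b, .and φ ψ => PosTC b φ ∧ PosTC b ψ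
  | b, .or φ ψ => PosTC b φ ∧ PosTC b ψ
  | b, .ex _ φ => PosTC b φ
  | b, .all _ φ => PosTC b φ
  | b, .tc _ _ φ _ _ => b = true ∧ PosTC b φ
  | _, _ => True

/-- The formula contains no transitive closure operator (pure first-order). -/
def TCFree {k : ℕ} : TForm Sig rank k → Prop
  | .not φ => TCFree φ
  | .and φ ψ => TCFree φ ∧ TCFree ψ
  | .or φ ψ => TCFree φ ∧ TCFree ψ
  | .ex _ φ => TCFree φ
  | .all _ φ => TCFree φ
  | .tc _ _ _ _ _ => False
  | _ => True

/-- The tree language defined by a (closed) formula. -/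
def treesOf {k : ℕ} (φ : TForm Sig rank k) : Set (RTree Sig rank) :=
  {t | Sat t φ fun _ => rootPos t}

/-- `FO+DTC^k`: tree languages definable by closed first-order formulas with `k`-ary
deterministic transitive closure. -/
def FODTC (Sig : Type) (rank : Sig → ℕ) (k : ℕ) : Set (Set (RTree Sig rank)) :=
  {L | ∃ φ : TForm Sig rank k, WF φ ∧ DetTC φ ∧ freeVars φ = ∅ ∧ L = treesOf φ}

/-- `FO+TC^k`: tree languages definable by closed first-order formulas with `k`-ary
transitive closure. -/
def FOTC (Sig : Type) (rank : Sig → ℕ) (k : ℕ) : Set (Set (RTree Sig rank)) :=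
  {L | ∃ φ : TForm Sig rank k, WF φ ∧ freeVars φ = ∅ ∧ L = treesOf φ}

/-- `FO+posTC^k`: tree languages definable by closed first-order formulas in which
every occurrence of the `k`-ary transitive closure operator is positive. -/
def FOposTC (Sig : Type) (rank : Sig → ℕ) (k : ℕ) : Set (Set (RTree Sig rank)) :=
  {L | ∃ φ : TForm Sig rank k, WF φ ∧ PosTC true φ ∧ freeVars φ = ∅ ∧ L = treesOf φ}

/-!  ### k-head tree-walking automata with nested pebbles  -/

/-- Tests of a `k`-head tree-walking automaton with pebble set `X`:
label of the node under head `i`, presence of pebble `x` at head `i`, and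
child number of the node under head `i`. -/
inductive TTest (Sig : Type) (k : ℕ) (X : Type) : Type
  | lab (i : Fin k) (a : Sig)
  | peb (i : Fin k) (x : X)
  | chno (i : Fin k) (j : ℕ)

/-- Instructions: move head `i` up / down to the `j`-th child (1-based), drop a
pebble at head `i`, retrieve the most recently dropped pebble (from a distance),
or perform a positive (`b = true`) or negated (`b = false`) test. -/
inductive TInstr (Sig : Type) (k : ℕ) (X : Type) : Type
  | up (i : Fin k)
  | down (i : Fin k) (j : ℕ)
  | dropPeb (i : Fin k) (x : X)
  | retrieve (x : X)
  | test (b : Bool) (τ : TTest Sig k X)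

/-- A `k`-head tree-walking automaton with nested pebbles: a finite state set `Q`,
a finite pebble set `X`, an initial state, accepting states, and a finite set of
instructions `⟨p, χ, q⟩`. -/
structure TWA (Sig : Type) (rank : Sig → ℕ) (k : ℕ) : Type 1 where
  Q : Type
  finQ : Fintype Q
  X : Type
  finX : Fintype X
  q0 : Q
  acc : Set Q
  instr : Set (Q × TInstr Sig k X × Q)
  instrFin : instr.Finite

/-- Configurations: a state, the positions of the `k` heads, and the stack of
dropped pebbles with their positions (most recent first). -/
abbrev TConf {Sig : Type} {rank : Sig → ℕ} {k : ℕ} (A : TWA Sig rank k)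
    (t : RTree Sig rank) : Type :=
  A.Q × (Fin k → Pos t) × List (A.X × Pos t)

/-- Semantics of tests. -/
def testHolds {k : ℕ} (t : RTree Sig rank) {X : Type} (τ : TTest Sig k X)
    (hs : Fin k → Pos t) (π : List (X × Pos t)) : Prop :=
  match τ with
  | .lab i a => labelAt t (hs i).1 = some a
  | .peb i x => (x, hs i) ∈ π
  | .chno i j => childNo (hs i).1 = j

/-- Semantics of a single instruction, relating head positions and pebble stacks
before and after. -/
def instrStep {k : ℕ} (t : RTree Sig rank) {X : Type} (ins : TInstr Sig k X)
    (hs : Fin k → Pos t) (π : List (X × Pos t))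
    (hs' : Fin k → Pos t) (π' : List (X × Pos t)) : Prop :=
  match ins with
  | .up i => π' = π ∧ (∃ j : ℕ, (hs i).1 = (hs' i).1 ++ [j]) ∧ ∀ h, h ≠ i → hs' h = hs h
  | .down i j => π' = π ∧ 1 ≤ j ∧ (hs' i).1 = (hs i).1 ++ [j - 1] ∧ ∀ h, h ≠ i → hs' h = hs h
  | .dropPeb i x => hs' = hs ∧ π' = (x, hs i) :: π ∧ ∀ w, (x, w) ∉ π
  | .retrieve x => hs' = hs ∧ ∃ w, π = (x, w) :: π'
  | .test b τ => hs' = hs ∧ π' = π ∧ (testHolds t τ hs π ↔ b = true)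

/-- The step relation of automaton `A` on tree `t`. -/
def Step {k : ℕ} (A : TWA Sig rank k) (t : RTree Sig rank) :
    TConf A t → TConf A t → Prop :=
  fun c c' => ∃ ins : TInstr Sig k A.X,
    (c.1, ins, c'.1) ∈ A.instr ∧ instrStep t ins c.2.1 c.2.2 c'.2.1 c'.2.2

/-- `χ'` is the negation of the test `χ`. -/
def negOf {k : ℕ} {X : Type} (χ χ' : TInstr Sig k X) : Prop :=
  ∃ b τ, χ = TInstr.test b τ ∧ χ' = TInstr.test (!b) τ

/-- Determinism: any two distinct instructions with the same source state consist
of a test and its negation. -/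
def Deterministic {k : ℕ} (A : TWA Sig rank k) : Prop :=
  ∀ p χ₁ q₁ χ₂ q₂, (p, χ₁, q₁) ∈ A.instr → (p, χ₂, q₂) ∈ A.instr →
    (χ₁, q₁) ≠ (χ₂, q₂) → negOf χ₁ χ₂ ∨ negOf χ₂ χ₁

/-- The initial configuration: initial state, all heads at the root, no pebbles. -/
def initConf {k : ℕ} (A : TWA Sig rank k) (t : RTree Sig rank) : TConf A t :=
  (A.q0, fun _ => rootPos t, [])

/-- A configuration is halting if no step is possible from it. -/
def HaltingConf {k : ℕ} (A : TWA Sig rank k) (t : RTree Sig rank) (c : TConf A t) : Prop :=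
  ∀ c', ¬ Step A t c c'

/-- Acceptance: some computation from the initial configuration halts in an
accepting state with all heads at the root and no pebbles on the tree. -/
def Accepts {k : ℕ} (A : TWA Sig rank k) (t : RTree Sig rank) : Prop :=
  ∃ q ∈ A.acc,
    Relation.ReflTransGen (Step A t) (initConf A t) (q, fun _ => rootPos t, []) ∧
    HaltingConf A t (q, fun _ => rootPos t, [])

/-- The tree language accepted by `A`. -/
def Lang {k : ℕ} (A : TWA Sig rank k) : Set (RTree Sig rank) := {t | Accepts A t}

/-- The automaton uses no pebbles at all. -/
def PebbleFree {k : ℕ} (A : TWA Sig rank k) : Prop :=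
  ∀ p χ q, (p, χ, q) ∈ A.instr →
    (∀ i x, χ ≠ TInstr.dropPeb i x) ∧ (∀ x, χ ≠ TInstr.retrieve x) ∧
    (∀ b i x, χ ≠ TInstr.test b (TTest.peb i x))

/-- `DPTWA^k`: tree languages accepted by deterministic `k`-head tree-walking
automata with nested pebbles. -/
def DPTWA (Sig : Type) (rank : Sig → ℕ) (k : ℕ) : Set (Set (RTree Sig rank)) :=
  {L | ∃ A : TWA Sig rank k, Deterministic A ∧ L = Lang A}

/-- `NPTWA^k`: tree languages accepted by nondeterministic `k`-head tree-walking
automata with nested pebbles. -/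
def NPTWA (Sig : Type) (rank : Sig → ℕ) (k : ℕ) : Set (Set (RTree Sig rank)) :=
  {L | ∃ A : TWA Sig rank k, L = Lang A}

/-- `NTWA^k`: tree languages accepted by nondeterministic `k`-head tree-walking
automata without pebbles. -/
def NTWA (Sig : Type) (rank : Sig → ℕ) (k : ℕ) : Set (Set (RTree Sig rank)) :=
  {L | ∃ A : TWA Sig rank k, PebbleFree A ∧ L = Lang A}

end NestedPebbles

namespace NestedPebbles

open Relation

set_option linter.unusedSectionVars false
set_option linter.unusedVariables false

section Fragments

variable {Sig : Type} {rank : Sig → ℕ} {k : ℕ}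

/-- A control node: an instruction with a continuation, or a test with two continuations. -/
inductive Node (Sig : Type) (k : ℕ) (B : Type) : Type
  | act (ins : TInstr Sig k ℕ) (n : B)
  | br (τ : TTest Sig k ℕ) (y n : B)

def Node.map {B C : Type} (h : B → C) : Node Sig k B → Node Sig k C
  | .act ins n => .act ins (h n)
  | .br τ y n => .br τ (h y) (h n)

/-- A deterministic program fragment with exits `E`; pebbles are natural numbers. -/
structure Frag (Sig : Type) (k : ℕ) (E : Type) : Type 1 where
  Q : Type
  fin : Finite Q
  q0 : Q
  δ : Q → Node Sig k (Q ⊕ E)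

abbrev St (t : RTree Sig rank) (k : ℕ) : Type := (Fin k → Pos t) × List (ℕ × Pos t)

inductive NStep (t : RTree Sig rank) {B : Type} : Node Sig k B → St t k → B → St t k → Prop
  | act {ins n s s'} : instrStep t ins s.1 s.2 s'.1 s'.2 → NStep t (.act ins n) s n s'
  | yes {τ y n s} : testHolds t τ s.1 s.2 → NStep t (.br τ y n) s y s
  | no {τ y n s} : ¬ testHolds t τ s.1 s.2 → NStep t (.br τ y n) s n s

theorem NStep.map {t : RTree Sig rank} {B C : Type} (f : B → C) {N : Node Sig k B}
    {s s' : St t k} {b : B} (h : NStep t N s b s') : NStep t (N.map f) s (f b) s' := by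
  cases h with
  | act h => exact .act h
  | yes h => exact .yes h
  | no h => exact .no h

inductive FStep {E : Type} (F : Frag Sig k E) (t : RTree Sig rank) :
    (F.Q ⊕ E) × St t k → (F.Q ⊕ E) × St t k → Prop
  | mk {q s b s'} : NStep t (F.δ q) s b s' → FStep F t (Sum.inl q, s) (b, s')

def Runs {E : Type} (F : Frag Sig k E) (t : RTree Sig rank) (s : St t k) (e : E)
    (s' : St t k) : Prop :=
  ReflTransGen (FStep F t) (Sum.inl F.q0, s) (Sum.inr e, s')

theorem lift_run {E E' : Type} {F : Frag Sig k E} {F' : Frag Sig k E'} {t : RTree Sig rank}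
    (h : F.Q ⊕ E → F'.Q ⊕ E')
    (hh : ∀ q, ∃ q', h (Sum.inl q) = Sum.inl q' ∧ F'.δ q' = (F.δ q).map h)
    {a b : (F.Q ⊕ E) × St t k} (hr : ReflTransGen (FStep F t) a b) :
    ReflTransGen (FStep F' t) (h a.1, a.2) (h b.1, b.2) := by
  refine ReflTransGen.lift (fun p : (F.Q ⊕ E) × St t k => (h p.1, p.2)) ?_ _ _ hr
  rintro _ _ ⟨hs⟩
  rename_i q s b s'
  obtain ⟨q', h1, h2⟩ := hh q
  change FStep F' t (h (Sum.inl q), s) (h b, s')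
  rw [h1]
  apply FStep.mk
  rw [h2]
  exact hs.map h

/-- Sequential composition. -/
def Frag.bind {E E' : Type} [Finite E] (F : Frag Sig k E) (G : E → Frag Sig k E') :
    Frag Sig k E' where
  Q := F.Q ⊕ (Σ e, (G e).Q)
  fin := by
    have := F.fin
    have := fun e => (G e).fin
    infer_instance
  q0 := Sum.inl F.q0
  δ
    | Sum.inl q => (F.δ q).map (fun b => match b with
        | Sum.inl q => Sum.inl (Sum.inl q)
        | Sum.inr e => Sum.inl (Sum.inr ⟨e, (G e).q0⟩))
    | Sum.inr ⟨e, q⟩ => ((G e).δ q).map (fun b => match b with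
        | Sum.inl q => Sum.inl (Sum.inr ⟨e, q⟩)
        | Sum.inr e' => Sum.inr e')

theorem Runs.bind {E E' : Type} [Finite E] {F : Frag Sig k E} {G : E → Frag Sig k E'}
    {t : RTree Sig rank} {s s1 s2 : St t k} {e : E} {e' : E'}
    (h1 : Runs F t s e s1) (h2 : Runs (G e) t s1 e' s2) : Runs (F.bind G) t s e' s2 := by
  have a := lift_run (F' := F.bind G) (fun b => match b with
        | Sum.inl q => Sum.inl (Sum.inl q)
        | Sum.inr e => Sum.inl (Sum.inr ⟨e, (G e).q0⟩)) (fun q => ⟨_, rfl, rfl⟩) h1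
  have b := lift_run (F' := F.bind G) (fun b => match b with
        | Sum.inl q => Sum.inl (Sum.inr ⟨e, q⟩)
        | Sum.inr e' => Sum.inr e') (fun q => ⟨_, rfl, rfl⟩) h2
  exact a.trans b

/-- Iteration. -/
def Frag.iter {A E : Type} [Finite A] (F : A → Frag Sig k (A ⊕ E)) (a : A) : Frag Sig k E where
  Q := Σ a, (F a).Q
  fin := by
    have := fun e => (F e).fin
    infer_instance
  q0 := ⟨a, (F a).q0⟩
  δ := fun ⟨a, q⟩ => ((F a).δ q).map (fun b => match b with
        | Sum.inl q => Sum.inl ⟨a, q⟩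
        | Sum.inr (Sum.inl a') => Sum.inl ⟨a', (F a').q0⟩
        | Sum.inr (Sum.inr e) => Sum.inr e)

theorem Runs.iter_exit {A E : Type} [Finite A] {F : A → Frag Sig k (A ⊕ E)} {a : A}
    {t : RTree Sig rank} {s s1 : St t k} {e : E}
    (h1 : Runs (F a) t s (Sum.inr e) s1) : Runs (Frag.iter F a) t s e s1 :=
  lift_run (F' := Frag.iter F a) (fun b => match b with
        | Sum.inl q => Sum.inl ⟨a, q⟩
        | Sum.inr (Sum.inl a') => Sum.inl ⟨a', (F a').q0⟩
        | Sum.inr (Sum.inr e) => Sum.inr e) (fun q => ⟨_, rfl, rfl⟩) h1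

theorem Runs.iter_step {A E : Type} [Finite A] {F : A → Frag Sig k (A ⊕ E)} {a a' : A}
    {t : RTree Sig rank} {s s1 s2 : St t k} {e : E}
    (h1 : Runs (F a) t s (Sum.inl a') s1) (h2 : Runs (Frag.iter F a') t s1 e s2) :
    Runs (Frag.iter F a) t s e s2 := by
  have a1 := lift_run (F' := Frag.iter F a) (fun b => match b with
        | Sum.inl q => Sum.inl ⟨a, q⟩
        | Sum.inr (Sum.inl a') => Sum.inl ⟨a', (F a').q0⟩
        | Sum.inr (Sum.inr e) => Sum.inr e) (fun q => ⟨_, rfl, rfl⟩) h1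
  have b1 := lift_run (F := Frag.iter F a') (F' := Frag.iter F a) id
    (fun q => ⟨q, rfl, by
      change (Frag.iter F a').δ q = _
      cases h : (Frag.iter F a').δ q <;> rfl⟩) h2
  exact a1.trans b1

/-- A single instruction. -/
def Frag.ins (i : TInstr Sig k ℕ) : Frag Sig k Unit where
  Q := Unit
  fin := inferInstance
  q0 := ()
  δ := fun _ => .act i (Sum.inr ())

theorem Runs.ins {i : TInstr Sig k ℕ} {t : RTree Sig rank} {s s' : St t k}
    (h : instrStep t i s.1 s.2 s'.1 s'.2) : Runs (Frag.ins i) t s () s' :=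
  ReflTransGen.single (FStep.mk (NStep.act h))

/-- A test. -/
def Frag.tst (τ : TTest Sig k ℕ) : Frag Sig k Bool where
  Q := Unit
  fin := inferInstance
  q0 := ()
  δ := fun _ => .br τ (Sum.inr true) (Sum.inr false)

/-- `F` decides `P` from `s`, ending in `s'`. -/
def Dec (F : Frag Sig k Bool) (t : RTree Sig rank) (s : St t k) (P : Prop) (s' : St t k) : Prop :=
  (P → Runs F t s true s') ∧ (¬ P → Runs F t s false s')

theorem Dec.congr {F : Frag Sig k Bool} {t : RTree Sig rank} {s s' : St t k} {P P' : Prop}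
    (h : Dec F t s P s') (hp : P ↔ P') : Dec F t s P' s' := by
  rwa [propext hp] at h

theorem Dec.tst {τ : TTest Sig k ℕ} {t : RTree Sig rank} {s : St t k} :
    Dec (Frag.tst τ) t s (testHolds t τ s.1 s.2) s :=
  ⟨fun h => ReflTransGen.single (FStep.mk (NStep.yes h)),
   fun h => ReflTransGen.single (FStep.mk (NStep.no h))⟩

variable [NeZero k]

/-- Exit immediately (realised by a vacuous test). -/
def Frag.ret {E : Type} (e : E) : Frag Sig k E where
  Q := Unit
  fin := inferInstance
  q0 := ()
  δ := fun _ => .br (.chno 0 0) (Sum.inr e) (Sum.inr e)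

theorem Runs.ret {E : Type} {e : E} {t : RTree Sig rank} {s : St t k} :
    Runs (Frag.ret e) t s e s := by
  by_cases h : testHolds t (.chno 0 0) s.1 s.2
  · exact ReflTransGen.single (FStep.mk (NStep.yes h))
  · exact ReflTransGen.single (FStep.mk (NStep.no h))

/-- Conditional. -/
def Frag.ite {E : Type} (F : Frag Sig k Bool) (G H : Frag Sig k E) : Frag Sig k E :=
  F.bind fun b => cond b G H

theorem Runs.ite_true {E : Type} {F : Frag Sig k Bool} {G H : Frag Sig k E} {e : E}
    {t : RTree Sig rank} {s s1 s2 : St t k}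
    (h1 : Runs F t s true s1) (h2 : Runs G t s1 e s2) : Runs (Frag.ite F G H) t s e s2 :=
  Runs.bind (e := true) h1 h2

theorem Runs.ite_false {E : Type} {F : Frag Sig k Bool} {G H : Frag Sig k E} {e : E}
    {t : RTree Sig rank} {s s1 s2 : St t k}
    (h1 : Runs F t s false s1) (h2 : Runs H t s1 e s2) : Runs (Frag.ite F G H) t s e s2 :=
  Runs.bind (e := false) h1 h2

def Frag.seq {E E' : Type} [Finite E] (F : Frag Sig k E) (G : Frag Sig k E') : Frag Sig k E' :=
  F.bind fun _ => G

theorem Runs.seq {E E' : Type} [Finite E] {F : Frag Sig k E} {G : Frag Sig k E'} {e : E} {e' : E'}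
    {t : RTree Sig rank} {s s1 s2 : St t k}
    (h1 : Runs F t s e s1) (h2 : Runs G t s1 e' s2) : Runs (Frag.seq F G) t s e' s2 :=
  Runs.bind h1 h2

/-- Run `F`, then a cleanup `G`, exiting with the result of `F`. -/
def Frag.fin' {E : Type} [Finite E] (F : Frag Sig k E) (G : Frag Sig k Unit) : Frag Sig k E :=
  F.bind fun b => G.bind fun _ => Frag.ret b

theorem Runs.fin' {E : Type} [Finite E] {F : Frag Sig k E} {G : Frag Sig k Unit} {e : E}
    {t : RTree Sig rank} {s s1 s2 : St t k}
    (h1 : Runs F t s e s1) (h2 : Runs G t s1 () s2) : Runs (Frag.fin' F G) t s e s2 :=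
  Runs.bind h1 (Runs.bind h2 Runs.ret)

theorem Dec.fin' {F : Frag Sig k Bool} {G : Frag Sig k Unit} {P : Prop}
    {t : RTree Sig rank} {s s1 s2 : St t k}
    (h1 : Dec F t s P s1) (h2 : Runs G t s1 () s2) : Dec (Frag.fin' F G) t s P s2 :=
  ⟨fun h => (h1.1 h).fin' h2, fun h => (h1.2 h).fin' h2⟩

theorem Dec.seq {E : Type} [Finite E] {e : E} {F : Frag Sig k E} {G : Frag Sig k Bool} {P : Prop}
    {t : RTree Sig rank} {s s1 s2 : St t k}
    (h1 : Runs F t s e s1) (h2 : Dec G t s1 P s2) : Dec (Frag.seq F G) t s P s2 :=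
  ⟨fun h => h1.seq (h2.1 h), fun h => h1.seq (h2.2 h)⟩

theorem Dec.ret_true {P : Prop} {t : RTree Sig rank} {s : St t k} (h : P) :
    Dec (Frag.ret true) t s P s := ⟨fun _ => Runs.ret, fun h' => absurd h h'⟩

theorem Dec.ret_false {P : Prop} {t : RTree Sig rank} {s : St t k} (h : ¬ P) :
    Dec (Frag.ret false) t s P s := ⟨fun h' => absurd h' h, fun _ => Runs.ret⟩

theorem Dec.ite {F G H : Frag Sig k Bool} {P R : Prop}
    {t : RTree Sig rank} {s s1 s2 : St t k}
    (h1 : Dec F t s P s1) (h2 : P → Dec G t s1 R s2) (h3 : ¬ P → Dec H t s1 R s2) :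
    Dec (Frag.ite F G H) t s R s2 := by
  by_cases h : P
  · exact ⟨fun hr => (h1.1 h).ite_true ((h2 h).1 hr), fun hr => (h1.1 h).ite_true ((h2 h).2 hr)⟩
  · exact ⟨fun hr => (h1.2 h).ite_false ((h3 h).1 hr), fun hr => (h1.2 h).ite_false ((h3 h).2 hr)⟩

end Fragments

section TreeOrder

variable {Sig : Type} {rank : Sig → ℕ}

theorem subtree_append (t : RTree Sig rank) (p q : List ℕ) :
    t.subtree (p ++ q) = (t.subtree p).bind fun s => s.subtree q := by
  induction p generalizing t with
  | nil => simp [RTree.subtree]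
  | cons i p ih =>
    simp only [List.cons_append, RTree.subtree]
    cases t.child i with
    | none => rfl
    | some s => simpa using ih s

theorem child_isSome (t : RTree Sig rank) (i : ℕ) :
    (t.child i).isSome = true ↔ i < rank t.label := by
  cases t with
  | node a c =>
    simp only [RTree.child, RTree.label]
    split <;> simp_all

def tsize : RTree Sig rank → ℕ
  | .node _ c => 1 + ∑ j, tsize (c j)

def csize (t : RTree Sig rank) (i : ℕ) : ℕ :=
  match t.child i with
  | some s => tsize s
  | none => 0

theorem tsize_eq (t : RTree Sig rank) :
    tsize t = 1 + ∑ i ∈ Finset.range (rank t.label), csize t i := by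
  cases t with
  | node a c =>
    simp only [tsize, RTree.label, Finset.sum_range]
    congr 1
    apply Finset.sum_congr rfl
    intro j _
    simp [csize, RTree.child]

theorem tsize_pos (t : RTree Sig rank) : 0 < tsize t := by
  rw [tsize_eq]; omega

def presum (t : RTree Sig rank) (i : ℕ) : ℕ := ∑ j ∈ Finset.range i, csize t j

theorem presum_succ (t : RTree Sig rank) (i : ℕ) : presum t (i + 1) = presum t i + csize t i :=
  Finset.sum_range_succ _ _

theorem presum_mono (t : RTree Sig rank) : Monotone (presum t) :=
  monotone_nat_of_le_succ fun n => by rw [presum_succ]; omega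

def tidx : RTree Sig rank → List ℕ → ℕ
  | _, [] => 0
  | t, i :: p =>
    match t.child i with
    | some s => 1 + presum t i + tidx s p
    | none => 0

theorem csize_some {t s : RTree Sig rank} {i : ℕ} (h : t.child i = some s) :
    csize t i = tsize s := by simp [csize, h]

theorem tidx_cons {t s : RTree Sig rank} {i : ℕ} (h : t.child i = some s) (p : List ℕ) :
    tidx t (i :: p) = 1 + presum t i + tidx s p := by simp [tidx, h]

theorem child_of_pos {t : RTree Sig rank} {i : ℕ} {p : List ℕ} (h : IsPos t (i :: p)) :
    ∃ s, t.child i = some s ∧ IsPos s p := by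
  unfold IsPos at *
  simp only [RTree.subtree] at h
  cases hc : t.child i with
  | none => simp [hc] at h
  | some s => exact ⟨s, rfl, by simpa [hc] using h⟩

theorem tidx_lt (t : RTree Sig rank) (p : List ℕ) (h : IsPos t p) : tidx t p < tsize t := by
  induction p generalizing t with
  | nil => exact tsize_pos t
  | cons i p ih =>
    obtain ⟨s, hc, hp⟩ := child_of_pos h
    rw [tidx_cons hc]
    have h1 := ih s hp
    have h2 : i < rank t.label := (child_isSome t i).1 (by simp [hc])
    have h3 := presum_mono t (Nat.succ_le_of_lt h2)
    rw [Nat.succ_eq_add_one, presum_succ, csize_some hc] at h3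
    have h4 := tsize_eq t
    change tsize t = 1 + presum t _ at h4
    omega

theorem tidx_inj (t : RTree Sig rank) (p q : List ℕ) (hp : IsPos t p) (hq : IsPos t q)
    (h : tidx t p = tidx t q) : p = q := by
  induction p generalizing t q with
  | nil =>
    cases q with
    | nil => rfl
    | cons j q =>
      obtain ⟨s, hc, _⟩ := child_of_pos hq
      rw [tidx_cons hc] at h
      simp only [tidx] at h
      omega
  | cons i p ih =>
    obtain ⟨s, hc, hp'⟩ := child_of_pos hp
    rw [tidx_cons hc] at h
    cases q with
    | nil => simp [tidx] at h
    | cons j q =>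
      obtain ⟨s', hc', hq'⟩ := child_of_pos hq
      rw [tidx_cons hc'] at h
      have l1 := tidx_lt s p hp'
      have l2 := tidx_lt s' q hq'
      have e1 := presum_succ t i
      have e2 := presum_succ t j
      rw [csize_some hc] at e1
      rw [csize_some hc'] at e2
      rcases lt_trichotomy i j with hij | hij | hij
      · have := presum_mono t (Nat.succ_le_of_lt hij)
        rw [Nat.succ_eq_add_one] at this
        omega
      · subst hij
        rw [hc] at hc'
        cases hc'
        rw [ih s q hp' hq' (by omega)]
      · have := presum_mono t (Nat.succ_le_of_lt hij)
        rw [Nat.succ_eq_add_one] at this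
        omega

theorem tidx_snoc (t s : RTree Sig rank) (q : List ℕ) (j : ℕ) (h : t.subtree q = some s)
    (hj : j < rank s.label) : tidx t (q ++ [j]) = tidx t q + 1 + presum s j := by
  induction q generalizing t with
  | nil =>
    simp only [RTree.subtree, Option.some.injEq] at h
    subst h
    obtain ⟨s', hs'⟩ := Option.isSome_iff_exists.1 ((child_isSome t j).2 hj)
    simp [tidx, hs']
  | cons i q ih =>
    have hp : IsPos t (i :: q) := by simp [IsPos, h]
    obtain ⟨s', hc, _⟩ := child_of_pos hp
    rw [List.cons_append, tidx_cons hc, tidx_cons hc, ih s']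
    · omega
    · simpa [RTree.subtree, hc] using h

theorem subtree_snoc {t s : RTree Sig rank} {q : List ℕ} (h : t.subtree q = some s) (j : ℕ) :
    t.subtree (q ++ [j]) = s.child j := by
  rw [subtree_append, h]
  simp only [Option.bind_some, RTree.subtree]
  cases s.child j <;> rfl

theorem isPos_snoc {t s : RTree Sig rank} {q : List ℕ} (h : t.subtree q = some s) (j : ℕ) :
    IsPos t (q ++ [j]) ↔ j < rank s.label := by
  rw [IsPos, subtree_snoc h, child_isSome]

theorem isPos_of_append {t : RTree Sig rank} {p q : List ℕ} (h : IsPos t (p ++ q)) : IsPos t p := by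
  unfold IsPos at *
  rw [subtree_append] at h
  cases hc : t.subtree p with
  | none => simp [hc] at h
  | some s => rfl

theorem Pos.ext' {t : RTree Sig rank} {p q : Pos t} (h : p.1 = q.1) : p = q := Subtype.ext h

theorem tidx_root (t : RTree Sig rank) : tidx t (rootPos t).1 = 0 := rfl

theorem childNo_nil : childNo [] = 0 := rfl

theorem childNo_snoc (q : List ℕ) (j : ℕ) : childNo (q ++ [j]) = j + 1 := by
  simp [childNo]

end TreeOrder

section Walk

variable {Sig : Type} {rank : Sig → ℕ} {k : ℕ} [NeZero k]

def anyLab (rank : Sig → ℕ) (i : Fin k) (j : ℕ) : List Sig → Frag Sig k Bool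
  | [] => Frag.ret false
  | a :: l => Frag.ite (Frag.tst (.lab i a)) (Frag.ret (decide (j < rank a))) (anyLab rank i j l)

theorem anyLab_spec (t : RTree Sig rank) (i : Fin k) (j : ℕ) (l : List Sig) (s : St t k)
    (u : RTree Sig rank) (hu : t.subtree (s.1 i).1 = some u) (hl : u.label ∈ l) :
    Dec (anyLab rank i j l) t s (j < rank u.label) s := by
  induction l with
  | nil => simp at hl
  | cons a l ih =>
    refine Dec.ite Dec.tst ?_ ?_
    · intro h
      have : u.label = a := by simpa [testHolds, labelAt, hu] using h
      rw [this]
      by_cases hj : j < rank a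
      · simp only [hj, decide_true]; exact Dec.ret_true trivial
      · simp only [hj, decide_false]; exact Dec.ret_false id
    · intro h
      have : u.label ≠ a := by simpa [testHolds, labelAt, hu] using h
      exact ih (by simpa [this] using hl)

def selN {E : Type} (i : Fin k) (G : ℕ → Frag Sig k E) : ℕ → Frag Sig k E
  | 0 => G 0
  | n + 1 => Frag.ite (Frag.tst (.chno i (n + 1))) (G (n + 1)) (selN i G n)

theorem selN_spec {E : Type} (t : RTree Sig rank) (i : Fin k) (G : ℕ → Frag Sig k E) (n : ℕ)
    (s s' : St t k) (e : E) (h : childNo (s.1 i).1 ≤ n)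
    (hr : Runs (G (childNo (s.1 i).1)) t s e s') : Runs (selN i G n) t s e s' := by
  induction n with
  | zero => rw [Nat.le_zero.1 h] at hr; exact hr
  | succ n ih =>
    by_cases hc : childNo (s.1 i).1 = n + 1
    · rw [hc] at hr
      exact Runs.ite_true (Dec.tst.1 hc) hr
    · exact Runs.ite_false (Dec.tst.2 hc) (ih (by omega))

variable [Fintype Sig]

noncomputable def hasChild (rank : Sig → ℕ) (i : Fin k) (j : ℕ) : Frag Sig k Bool :=
  anyLab rank i j (Finset.univ : Finset Sig).toList

theorem hasChild_spec (t : RTree Sig rank) (i : Fin k) (j : ℕ) (s : St t k)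
    (u : RTree Sig rank) (hu : t.subtree (s.1 i).1 = some u) :
    Dec (hasChild rank i j) t s (j < rank u.label) s :=
  anyLab_spec t i j _ s u hu (by simp)

noncomputable def climb (rank : Sig → ℕ) (i : Fin k) : Frag Sig k Bool :=
  Frag.iter (A := Unit) (fun _ =>
    selN i (fun j => Nat.casesOn j (Frag.ret (Sum.inr false)) fun j =>
      (Frag.ins (.up i)).seq (Frag.ite (hasChild rank i (j + 1))
        ((Frag.ins (.down i (j + 2))).seq (Frag.ret (Sum.inr true)))
        (Frag.ret (Sum.inl ())))) (Finset.univ.sup rank)) ()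

noncomputable def next1 (rank : Sig → ℕ) (i : Fin k) : Frag Sig k Bool :=
  Frag.ite (hasChild rank i 0) ((Frag.ins (.down i 1)).seq (Frag.ret true)) (climb rank i)

theorem run_down (t : RTree Sig rank) (i : Fin k) (j : ℕ) (hs : Fin k → Pos t)
    (π : List (ℕ × Pos t)) (p' : Pos t) (h : p'.1 = (hs i).1 ++ [j]) :
    Runs (Frag.ins (.down i (j + 1))) t (hs, π) () (Function.update hs i p', π) := by
  apply Runs.ins
  refine ⟨rfl, by omega, by simpa using h, fun h hh => by simp [hh]⟩

theorem run_up (t : RTree Sig rank) (i : Fin k) (j : ℕ) (hs : Fin k → Pos t)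
    (π : List (ℕ × Pos t)) (p' : Pos t) (h : (hs i).1 = p'.1 ++ [j]) :
    Runs (Frag.ins (.up i)) t (hs, π) () (Function.update hs i p', π) := by
  apply Runs.ins
  refine ⟨rfl, ⟨j, by simpa using h⟩, fun h hh => by simp [hh]⟩

theorem climb_spec (t : RTree Sig rank) (i : Fin k) (π : List (ℕ × Pos t)) (p : List ℕ) :
    ∀ (hs : Fin k → Pos t) (u : RTree Sig rank), (hs i).1 = p → t.subtree p = some u →
    (∃ p' : Pos t, tidx t p'.1 = tidx t p + tsize u ∧
      Runs (climb rank i) t (hs, π) true (Function.update hs i p', π)) ∨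
    (tidx t p + tsize u = tsize t ∧
      Runs (climb rank i) t (hs, π) false (Function.update hs i (rootPos t), π)) := by
  induction p using List.reverseRecOn with
  | nil =>
    intro hs u hp hu
    right
    simp only [RTree.subtree, Option.some.injEq] at hu
    subst hu
    refine ⟨by simp [tidx], ?_⟩
    have e : Function.update hs i (rootPos t) = hs := by
      rw [Function.update_eq_self_iff]
      exact Pos.ext' hp.symm
    rw [e]
    apply Runs.iter_exit
    apply selN_spec
    · simp [hp, childNo_nil]
    · simp only [hp, childNo_nil]
      exact Runs.ret
  | append_singleton q j ih =>
    intro hs u hp hu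
    have hpos : IsPos t (q ++ [j]) := by simp [IsPos, hu]
    have hqpos := isPos_of_append hpos
    obtain ⟨w, hw⟩ := Option.isSome_iff_exists.1 hqpos
    have hj := (isPos_snoc hw j).1 hpos
    have hcu : w.child j = some u := by rw [← subtree_snoc hw, hu]
    have hidx := tidx_snoc t w q j hw hj
    have hle : childNo (q ++ [j]) ≤ Finset.univ.sup rank := by
      rw [childNo_snoc]
      exact le_trans (Nat.succ_le_of_lt hj) (Finset.le_sup (f := rank) (Finset.mem_univ w.label))
    obtain ⟨qp, hqp⟩ : ∃ qp : Pos t, qp.1 = q := ⟨⟨q, hqpos⟩, rfl⟩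
    have hup := run_up t i j hs π qp (by rw [hqp, hp])
    have hdec := hasChild_spec t i (j + 1) (Function.update hs i qp, π) w (by simpa [hqp] using hw)
    by_cases hn : j + 1 < rank w.label
    · left
      have hpos' := (isPos_snoc hw (j + 1)).2 hn
      obtain ⟨rp, hrp⟩ : ∃ rp : Pos t, rp.1 = q ++ [j + 1] := ⟨⟨_, hpos'⟩, rfl⟩
      refine ⟨rp, ?_, ?_⟩
      · rw [hrp, tidx_snoc t w q _ hw hn, hidx, presum_succ, csize_some hcu]
        omega
      · apply Runs.iter_exit
        apply selN_spec
        · simp only [hp]; exact hle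
        · simp only [hp, childNo_snoc]
          refine hup.seq (Runs.ite_true (hdec.1 hn) (Runs.seq (e := ()) ?_ Runs.ret))
          have := run_down t i (j + 1) (Function.update hs i qp) π rp
            (by simp [hqp, hrp])
          simpa using this
    · have hlast : tidx t q + tsize w = tidx t (q ++ [j]) + tsize u := by
        have : rank w.label = j + 1 := by omega
        rw [hidx, tsize_eq w, this]
        change _ + (1 + presum w (j + 1)) = _
        rw [presum_succ, csize_some hcu]
        omega
      have hstep : ∀ b s', Runs (climb rank i) t (Function.update hs i qp, π) b s' →
          Runs (climb rank i) t (hs, π) b s' := by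
        intro b s' hr
        refine Runs.iter_step (a' := ()) ?_ hr
        apply selN_spec
        · simp only [hp]; exact hle
        · simp only [hp, childNo_snoc]
          exact hup.seq (Runs.ite_false (hdec.2 hn) Runs.ret)
      rcases ih (Function.update hs i qp) w (by simp [hqp]) hw with ⟨p', h1, h2⟩ | ⟨h1, h2⟩
      · left
        exact ⟨p', by omega, hstep _ _ (by simpa using h2)⟩
      · right
        exact ⟨by omega, hstep _ _ (by simpa using h2)⟩

theorem next1_spec (t : RTree Sig rank) (i : Fin k) (π : List (ℕ × Pos t)) (hs : Fin k → Pos t) :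
    (∃ p' : Pos t, tidx t p'.1 = tidx t (hs i).1 + 1 ∧
      Runs (next1 rank i) t (hs, π) true (Function.update hs i p', π)) ∨
    (tidx t (hs i).1 + 1 = tsize t ∧
      Runs (next1 rank i) t (hs, π) false (Function.update hs i (rootPos t), π)) := by
  obtain ⟨u, hu⟩ := Option.isSome_iff_exists.1 (hs i).2
  have hdec := hasChild_spec t i 0 (hs, π) u hu
  by_cases h0 : 0 < rank u.label
  · left
    refine ⟨⟨(hs i).1 ++ [0], (isPos_snoc hu 0).2 h0⟩, ?_, ?_⟩
    · simp only
      rw [tidx_snoc t u _ 0 hu h0]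
      simp [presum]
    · exact Runs.ite_true (hdec.1 h0) (Runs.seq (run_down t i 0 hs π _ rfl) Runs.ret)
  · have h1 : tsize u = 1 := by
      rw [tsize_eq]
      have : rank u.label = 0 := by omega
      simp [this]
    have := climb_spec t i π _ hs u rfl hu
    rw [h1] at this
    rcases this with ⟨p', ha, hb⟩ | ⟨ha, hb⟩
    · exact Or.inl ⟨p', ha, Runs.ite_false (hdec.2 h0) hb⟩
    · exact Or.inr ⟨ha, Runs.ite_false (hdec.2 h0) hb⟩

/-- Odometer on the first `n` heads. -/
noncomputable def nextN (rank : Sig → ℕ) : ℕ → Frag Sig k Bool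
  | 0 => Frag.ret false
  | n + 1 => Frag.ite (nextN rank n) (Frag.ret true)
      (if h : n < k then next1 rank ⟨n, h⟩ else Frag.ret false)

def ixN (t : RTree Sig rank) (hs : Fin k → Pos t) : ℕ → ℕ
  | 0 => 0
  | n + 1 => ixN t hs n + (if h : n < k then tidx t (hs ⟨n, h⟩).1 else 0) * tsize t ^ n

theorem ixN_congr (t : RTree Sig rank) (hs hs' : Fin k → Pos t) (n : ℕ)
    (h : ∀ i : Fin k, i.1 < n → hs i = hs' i) : ixN t hs n = ixN t hs' n := by
  induction n with
  | zero => rfl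
  | succ n ih =>
    simp only [ixN]
    rw [ih fun i hi => h i (by omega)]
    split
    · rw [h ⟨n, _⟩ (by simp)]
    · rfl

theorem ixN_lt (t : RTree Sig rank) (hs : Fin k → Pos t) (n : ℕ) : ixN t hs n < tsize t ^ n := by
  induction n with
  | zero => simp [ixN]
  | succ n ih =>
    simp only [ixN]
    have : (if h : n < k then tidx t (hs ⟨n, h⟩).1 else 0) + 1 ≤ tsize t := by
      split
      · exact tidx_lt t _ (hs _).2
      · exact tsize_pos t
    have := Nat.mul_le_mul_right (tsize t ^ n) this
    rw [pow_succ, mul_comm (tsize t ^ n)]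
    rw [add_mul] at this
    omega

theorem ixN_inj (t : RTree Sig rank) (hs hs' : Fin k → Pos t) (n : ℕ)
    (h : ixN t hs n = ixN t hs' n) : ∀ i : Fin k, i.1 < n → hs i = hs' i := by
  induction n with
  | zero => intro i hi; omega
  | succ n ih =>
    intro i hi
    simp only [ixN] at h
    have l1 := ixN_lt t hs n
    have l2 := ixN_lt t hs' n
    have hm := congrArg (· % tsize t ^ n) h
    have hd := congrArg (· / tsize t ^ n) h
    have hp : 0 < tsize t ^ n := pow_pos (tsize_pos t) n
    simp only [Nat.add_mul_mod_self_right, Nat.mod_eq_of_lt l1, Nat.mod_eq_of_lt l2] at hm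
    simp only [Nat.add_mul_div_right _ _ hp, Nat.div_eq_of_lt l1, Nat.div_eq_of_lt l2] at hd
    by_cases hin : i.1 < n
    · exact ih hm i hin
    · have hi' : n < k := by have := i.2; omega
      have e : i = ⟨n, hi'⟩ := by ext; simp; omega
      simp only [hi', dite_true, zero_add] at hd
      rw [e]
      exact Pos.ext' (tidx_inj t _ _ (hs _).2 (hs' _).2 hd)

theorem nextN_spec (t : RTree Sig rank) (π : List (ℕ × Pos t)) (hs : Fin k → Pos t) (n : ℕ)
    (hn : n ≤ k) :
    (∃ hs' : Fin k → Pos t, (∀ i : Fin k, n ≤ i.1 → hs' i = hs i) ∧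
      ixN t hs' n = ixN t hs n + 1 ∧ Runs (nextN rank n) t (hs, π) true (hs', π)) ∨
    (ixN t hs n + 1 = tsize t ^ n ∧
      Runs (nextN rank n) t (hs, π) false
        (fun i => if i.1 < n then rootPos t else hs i, π)) := by
  induction n with
  | zero => exact Or.inr ⟨by simp [ixN], by
      simp only [Nat.not_lt_zero, if_false]
      exact Runs.ret⟩
  | succ n ih =>
    have hnk : n < k := by omega
    rcases ih (by omega) with ⟨hs', h1, h2, h3⟩ | ⟨h2, h3⟩
    · left
      refine ⟨hs', fun i hi => h1 i (by omega), ?_, Runs.ite_true h3 Runs.ret⟩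
      simp only [ixN, hnk, dite_true, h2]
      rw [h1 ⟨n, hnk⟩ le_rfl]
      omega
    · set hs1 : Fin k → Pos t := fun i => if i.1 < n then rootPos t else hs i with hs1def
      have e1 : hs1 ⟨n, hnk⟩ = hs ⟨n, hnk⟩ := by simp [hs1def]
      have z : ∀ m, ixN t (fun _ : Fin k => rootPos t) m = 0 := by
        intro m
        induction m with
        | zero => rfl
        | succ m ih => simp [ixN, ih, tidx_root]
      rcases next1_spec t ⟨n, hnk⟩ π hs1 with ⟨p', ha, hb⟩ | ⟨ha, hb⟩
      · left
        refine ⟨Function.update hs1 ⟨n, hnk⟩ p', ?_, ?_, Runs.ite_false h3 (by simpa [hnk] using hb)⟩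
        · intro i hi
          have : i ≠ ⟨n, hnk⟩ := by intro h; rw [h] at hi; simp at hi
          have h' : ¬ i.1 < n := by omega
          simp [Function.update_of_ne this, hs1def, h']
        · simp only [ixN, hnk, dite_true, Function.update_self, ha, e1]
          rw [ixN_congr t _ (fun _ => rootPos t) n, z, add_mul]
          · omega
          · intro i hi
            have : i ≠ ⟨n, hnk⟩ := by intro h; rw [h] at hi; simp at hi
            simp [Function.update_of_ne this, hs1def, hi]
      · right
        constructor
        · rw [e1] at ha
          simp only [ixN, hnk, dite_true]
          rw [pow_succ, mul_comm (tsize t ^ n), ← ha, add_mul]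
          rw [← ha] at h2
          omega
        · refine Runs.ite_false h3 ?_
          simp only [hnk, dite_true]
          convert hb using 2
          funext i
          by_cases hi : i = ⟨n, hnk⟩
          · subst hi; simp
          · have : i.1 ≠ n := fun h => hi (Fin.ext h)
            rw [Function.update_of_ne hi]
            simp only [hs1def]
            by_cases h' : i.1 < n
            · simp [h', Nat.lt_succ_of_lt h']
            · have : ¬ i.1 < n + 1 := by omega
              simp [h', this]

/-- The all-root tuple. -/
def roots (t : RTree Sig rank) (k : ℕ) : Fin k → Pos t := fun _ => rootPos t

theorem roots_apply (t : RTree Sig rank) (k : ℕ) (i : Fin k) : roots t k i = rootPos t := rfl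

def ix (t : RTree Sig rank) (hs : Fin k → Pos t) : ℕ := ixN t hs k

theorem ix_inj (t : RTree Sig rank) : Function.Injective (ix (k := k) t) := fun a b h =>
  funext fun i => ixN_inj t a b k h i i.2

theorem ix_lt (t : RTree Sig rank) (a : Fin k → Pos t) : ix t a < tsize t ^ k := ixN_lt t a k

theorem ix_roots (t : RTree Sig rank) : ix t (roots t k) = 0 := by
  have z : ∀ m, ixN t (roots t k) m = 0 := by
    intro m
    induction m with
    | zero => rfl
    | succ m ih => simp [ixN, ih, roots_apply, tidx_root]
  exact z k

theorem finite_tuples (t : RTree Sig rank) : Finite (Fin k → Pos t) :=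
  Finite.of_injective (fun a => (⟨ix t a, ix_lt t a⟩ : Fin (tsize t ^ k)))
    fun a b h => ix_inj t (by simpa using h)

noncomputable def nextT (rank : Sig → ℕ) (k : ℕ) [NeZero k] : Frag Sig k Bool := nextN rank k

theorem nextT_spec (t : RTree Sig rank) (π : List (ℕ × Pos t)) (hs : Fin k → Pos t) :
    (∃ hs' : Fin k → Pos t, ix t hs' = ix t hs + 1 ∧ Runs (nextT rank k) t (hs, π) true (hs', π)) ∨
    ((∀ y : Fin k → Pos t, ix t y ≤ ix t hs) ∧
      Runs (nextT rank k) t (hs, π) false (roots t k, π)) := by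
  rcases nextN_spec t π hs k le_rfl with ⟨hs', _, h1, h2⟩ | ⟨h1, h2⟩
  · exact Or.inl ⟨hs', h1, h2⟩
  · right
    constructor
    · intro y
      have := ix_lt t y
      change ix t hs + 1 = _ at h1
      omega
    · simp only [Fin.is_lt, if_true] at h2
      exact h2

end Walk

section Search

variable {Sig : Type} {rank : Sig → ℕ} {k : ℕ} [NeZero k] [Fintype Sig]

noncomputable def toRoots (rank : Sig → ℕ) (k : ℕ) [NeZero k] : Frag Sig k Unit :=
  Frag.iter (A := Unit) (fun _ => Frag.ite (nextT rank k) (Frag.ret (Sum.inl ()))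
    (Frag.ret (Sum.inr ()))) ()

theorem toRoots_spec (t : RTree Sig rank) (π : List (ℕ × Pos t)) (hs : Fin k → Pos t) :
    Runs (toRoots rank k) t (hs, π) () (roots t k, π) := by
  induction h : tsize t ^ k - ix t hs using Nat.strong_induction_on generalizing hs with
  | _ n ih =>
    have hlt := ix_lt t hs
    rcases nextT_spec t π hs with ⟨hs', h1, h2⟩ | ⟨_, h2⟩
    · exact Runs.iter_step (a' := ()) (h2.ite_true Runs.ret) (ih _ (by omega) hs' rfl)
    · exact Runs.iter_exit (h2.ite_false Runs.ret)

/-- Search, from the current tuple of head positions, for the first tuple that passes `T`. -/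
noncomputable def search (rank : Sig → ℕ) (T : Frag Sig k Bool) : Frag Sig k Bool :=
  Frag.iter (A := Unit) (fun _ => Frag.ite T (Frag.ret (Sum.inr true))
    (Frag.ite (nextT rank k) (Frag.ret (Sum.inl ())) (Frag.ret (Sum.inr false)))) ()

theorem search_true (t : RTree Sig rank) (π : List (ℕ × Pos t)) {T : Frag Sig k Bool}
    {P : (Fin k → Pos t) → Prop} (hT : ∀ x, Dec T t (x, π) (P x) (x, π)) (a c : Fin k → Pos t)
    (ha : P a) (hca : ix t c ≤ ix t a) (hmin : ∀ y, ix t c ≤ ix t y → ix t y < ix t a → ¬ P y) :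
    Runs (search rank T) t (c, π) true (a, π) := by
  induction h : ix t a - ix t c using Nat.strong_induction_on generalizing c with
  | _ n ih =>
    by_cases hc : P c
    · have : c = a := by
        apply ix_inj t
        by_contra hne
        exact hmin c le_rfl (by omega) hc
      subst this
      exact Runs.iter_exit (((hT c).1 hc).ite_true Runs.ret)
    · have hne : ix t c ≠ ix t a := fun h => hc (ix_inj t h ▸ ha)
      rcases nextT_spec t π c with ⟨c', h1, h2⟩ | ⟨hmax, _⟩
      · exact Runs.iter_step (a' := ()) (((hT c).2 hc).ite_false (h2.ite_true Runs.ret))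
          (ih _ (by omega) c' (by omega) (fun y hy => hmin y (by omega)) rfl)
      · have := hmax a
        omega

theorem search_false (t : RTree Sig rank) (π : List (ℕ × Pos t)) {T : Frag Sig k Bool}
    {P : (Fin k → Pos t) → Prop} (hT : ∀ x, Dec T t (x, π) (P x) (x, π)) (c : Fin k → Pos t)
    (hno : ∀ y, ix t c ≤ ix t y → ¬ P y) :
    Runs (search rank T) t (c, π) false (roots t k, π) := by
  induction h : tsize t ^ k - ix t c using Nat.strong_induction_on generalizing c with
  | _ n ih =>
    have hlt := ix_lt t c
    have hc := (hT c).2 (hno c le_rfl)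
    rcases nextT_spec t π c with ⟨c', h1, h2⟩ | ⟨_, h2⟩
    · exact Runs.iter_step (a' := ()) (hc.ite_false (h2.ite_true Runs.ret))
        (ih _ (by omega) c' (fun y hy => hno y (by omega)) rfl)
    · exact Runs.iter_exit (hc.ite_false (h2.ite_false Runs.ret))

def eqL (f : Fin k → ℕ) : List (Fin k) → Frag Sig k Bool
  | [] => Frag.ret true
  | i :: l => Frag.ite (Frag.tst (.peb i (f i))) (eqL f l) (Frag.ret false)

theorem eqL_spec (t : RTree Sig rank) (f : Fin k → ℕ) (l : List (Fin k)) (s : St t k) :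
    Dec (eqL f l) t s (∀ i ∈ l, (f i, s.1 i) ∈ s.2) s := by
  induction l with
  | nil => exact Dec.ret_true (by simp)
  | cons i l ih =>
    refine Dec.ite Dec.tst ?_ ?_
    · intro h
      refine ih.congr ?_
      simp only [testHolds] at h
      simp [h]
    · intro h
      apply Dec.ret_false
      simp only [testHolds] at h
      simp [h]

/-- Test whether all heads are at the pebbles given by `f`. -/
def eqT (f : Fin k → ℕ) : Frag Sig k Bool := eqL f (List.finRange k)

/-- Well-formed pebble stacks with pebbles below `d`. -/
def StackOK {t : RTree Sig rank} (d : ℕ) (π : List (ℕ × Pos t)) : Prop :=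
  (∀ x w, (x, w) ∈ π → x < d) ∧ ∀ x w w', (x, w) ∈ π → (x, w') ∈ π → w = w'

theorem eqT_spec (t : RTree Sig rank) (f : Fin k → ℕ) (d : ℕ) (π : List (ℕ × Pos t))
    (hπ : StackOK d π) (a : Fin k → Pos t) (ha : ∀ i, (f i, a i) ∈ π) (x : Fin k → Pos t) :
    Dec (eqT f) t (x, π) (x = a) (x, π) := by
  refine (eqL_spec t f (List.finRange k) (x, π)).congr ?_
  constructor
  · intro h
    funext i
    exact hπ.2 _ _ _ (h i (List.mem_finRange i)) (ha i)
  · rintro rfl i _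
    exact ha i

/-- Move all heads to the pebbles given by `f`. -/
noncomputable def goTo (rank : Sig → ℕ) (f : Fin k → ℕ) : Frag Sig k Unit :=
  (toRoots rank k).seq ((search rank (eqT f)).seq (Frag.ret ()))

theorem goTo_spec (t : RTree Sig rank) (f : Fin k → ℕ) (d : ℕ) (π : List (ℕ × Pos t))
    (hπ : StackOK d π) (a : Fin k → Pos t) (ha : ∀ i, (f i, a i) ∈ π) (x : Fin k → Pos t) :
    Runs (goTo rank f) t (x, π) () (a, π) := by
  refine (toRoots_spec t π x).seq (Runs.seq (search_true t π (eqT_spec t f d π hπ a ha) a _ rfl ?_ ?_)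
    Runs.ret)
  · rw [ix_roots]; omega
  · rintro y _ h rfl
    omega

def dropL (d : ℕ) : List (Fin k) → Frag Sig k Unit
  | [] => Frag.ret ()
  | i :: l => (Frag.ins (.dropPeb i (d + i.1))).seq (dropL d l)

def retrL (d : ℕ) : List (Fin k) → Frag Sig k Unit
  | [] => Frag.ret ()
  | i :: l => (retrL d l).seq (Frag.ins (.retrieve (d + i.1)))

def pushL {t : RTree Sig rank} (d : ℕ) (a : Fin k → Pos t) :
    List (Fin k) → List (ℕ × Pos t) → List (ℕ × Pos t)
  | [], π => π
  | i :: l, π => pushL d a l ((d + i.1, a i) :: π)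

theorem dropL_spec (t : RTree Sig rank) (d : ℕ) (a : Fin k → Pos t) (l : List (Fin k))
    (hl : l.Nodup) (π : List (ℕ × Pos t)) (h : ∀ i ∈ l, ∀ w, (d + i.1, w) ∉ π) :
    Runs (dropL d l) t (a, π) () (a, pushL d a l π) := by
  induction l generalizing π with
  | nil => exact Runs.ret
  | cons i l ih =>
    rw [List.nodup_cons] at hl
    refine Runs.seq (e := ()) (s1 := (a, (d + i.1, a i) :: π)) (Runs.ins ?_) (ih hl.2 _ ?_)
    · exact ⟨rfl, rfl, h i (by simp)⟩
    · intro j hj w hw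
      rcases List.mem_cons.1 hw with hw | hw
      · simp only [Prod.mk.injEq] at hw
        have : j = i := Fin.ext (by omega)
        exact hl.1 (this ▸ hj)
      · exact h j (by simp [hj]) w hw

theorem retrL_spec (t : RTree Sig rank) (d : ℕ) (a x : Fin k → Pos t) (l : List (Fin k))
    (π : List (ℕ × Pos t)) : Runs (retrL d l) t (x, pushL d a l π) () (x, π) := by
  induction l generalizing π with
  | nil => exact Runs.ret
  | cons i l ih =>
    exact Runs.seq (ih _) (Runs.ins ⟨rfl, a i, rfl⟩)

theorem mem_pushL {t : RTree Sig rank} (d : ℕ) (a : Fin k → Pos t) (l : List (Fin k))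
    (π : List (ℕ × Pos t)) (x : ℕ) (w : Pos t) :
    (x, w) ∈ pushL d a l π ↔ (∃ i ∈ l, x = d + i.1 ∧ w = a i) ∨ (x, w) ∈ π := by
  induction l generalizing π with
  | nil => simp [pushL]
  | cons i l ih =>
    simp only [pushL, ih, List.mem_cons, Prod.mk.injEq, exists_eq_or_imp]
    rw [← or_assoc]
    exact or_congr_left or_comm

def push {t : RTree Sig rank} (d : ℕ) (a : Fin k → Pos t) (π : List (ℕ × Pos t)) :
    List (ℕ × Pos t) := pushL d a (List.finRange k) π

def dropAll (d : ℕ) : Frag Sig k Unit := dropL d (List.finRange k)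

def retrAll (d : ℕ) : Frag Sig k Unit := retrL d (List.finRange k)

theorem mem_push {t : RTree Sig rank} (d : ℕ) (a : Fin k → Pos t)
    (π : List (ℕ × Pos t)) (x : ℕ) (w : Pos t) :
    (x, w) ∈ push d a π ↔ (∃ i : Fin k, x = d + i.1 ∧ w = a i) ∨ (x, w) ∈ π := by
  simp [push, mem_pushL]

theorem dropAll_spec (t : RTree Sig rank) (d : ℕ) (a : Fin k → Pos t) (π : List (ℕ × Pos t))
    (hπ : StackOK d π) : Runs (dropAll d) t (a, π) () (a, push d a π) :=
  dropL_spec t d a _ (List.nodup_finRange k) π fun i _ w hw => by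
    have := hπ.1 _ _ hw
    omega

theorem retrAll_spec (t : RTree Sig rank) (d : ℕ) (a x : Fin k → Pos t) (π : List (ℕ × Pos t)) :
    Runs (retrAll d) t (x, push d a π) () (x, π) := retrL_spec t d a x _ π

theorem StackOK.push {t : RTree Sig rank} {d : ℕ} {π : List (ℕ × Pos t)} (h : StackOK d π)
    (a : Fin k → Pos t) : StackOK (d + k) (push d a π) := by
  constructor
  · intro x w hx
    rcases (mem_push d a π x w).1 hx with ⟨i, rfl, _⟩ | hx
    · have := i.2; omega
    · have := h.1 x w hx; omega
  · intro x w w' hw hw'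
    rcases (mem_push d a π x w).1 hw with ⟨i, e, e2⟩ | hx <;>
    rcases (mem_push d a π x w').1 hw' with ⟨j, e', e2'⟩ | hx'
    · have : i = j := Fin.ext (by omega)
      rw [e2, e2', this]
    · have := h.1 _ _ hx'; omega
    · have := h.1 _ _ hx; omega
    · exact h.2 x w w' hx hx'

/-- Pebbles given by `ρ` represent the valuation `ν`. -/
def Inv {t : RTree Sig rank} (ρ : ℕ → ℕ) (d : ℕ) (ν : ℕ → Pos t) (π : List (ℕ × Pos t)) : Prop :=
  StackOK d π ∧ ∀ x, (ρ x, ν x) ∈ π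

theorem Inv.push {t : RTree Sig rank} {ρ : ℕ → ℕ} {d : ℕ} {ν : ℕ → Pos t} {π : List (ℕ × Pos t)}
    (h : Inv ρ d ν π) (a : Fin k → Pos t) : Inv ρ (d + k) ν (push d a π) :=
  ⟨h.1.push a, fun x => (mem_push ..).2 (Or.inr (h.2 x))⟩

theorem Inv.updVec {t : RTree Sig rank} {ρ : ℕ → ℕ} {d : ℕ} {ν : ℕ → Pos t}
    {π : List (ℕ × Pos t)} (h : Inv ρ d ν π) (xs : Fin k → ℕ) (f : Fin k → ℕ) (a : Fin k → Pos t)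
    (hf : ∀ i, (f i, a i) ∈ π) : Inv (updVec ρ xs f) d (updVec ν xs a) π := by
  refine ⟨h.1, fun x => ?_⟩
  unfold NestedPebbles.updVec
  split
  · exact hf _
  · exact h.2 x

theorem Inv.update {t : RTree Sig rank} {ρ : ℕ → ℕ} {d : ℕ} {ν : ℕ → Pos t}
    {π : List (ℕ × Pos t)} (h : Inv ρ d ν π) (y : ℕ) (f : ℕ) (a : Pos t)
    (hf : (f, a) ∈ π) : Inv (Function.update ρ y f) d (Function.update ν y a) π := by
  refine ⟨h.1, fun x => ?_⟩
  by_cases hx : x = y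
  · subst hx; simpa using hf
  · simpa [hx] using h.2 x

theorem push_mem_self {t : RTree Sig rank} (d : ℕ) (a : Fin k → Pos t) (π : List (ℕ × Pos t))
    (i : Fin k) : (d + i.1, a i) ∈ push d a π := (mem_push ..).2 (Or.inl ⟨i, rfl, rfl⟩)

theorem push_mem_of {t : RTree Sig rank} (d : ℕ) (a : Fin k → Pos t) {π : List (ℕ × Pos t)}
    {p : ℕ × Pos t} (h : p ∈ π) : p ∈ push d a π := (mem_push d a π p.1 p.2).2 (Or.inr h)

/-- Mark the head positions by pebbles, run `F` from the root, and restore the heads. -/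
noncomputable def evalAt (rank : Sig → ℕ) (d : ℕ) (F : Frag Sig k Bool) : Frag Sig k Bool :=
  (dropAll d).seq ((toRoots rank k).seq (Frag.fin' F
    ((goTo rank fun i => d + i.1).seq (retrAll d))))

theorem evalAt_spec (t : RTree Sig rank) (d : ℕ) (F : Frag Sig k Bool) (π : List (ℕ × Pos t))
    (hπ : StackOK d π) (a : Fin k → Pos t) (P : Prop)
    (hF : Dec F t (roots t k, push d a π) P (roots t k, push d a π)) :
    Dec (evalAt rank d F) t (a, π) P (a, π) :=
  Dec.seq (dropAll_spec t d a π hπ) (Dec.seq (toRoots_spec t _ a) (hF.fin'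
    ((goTo_spec t _ (d + k) _ (hπ.push a) a (push_mem_self d a π) _).seq
      (retrAll_spec t d a a π))))

end Search

section DFS

/-- `x` is the first element of index at least `n` that satisfies `P`. -/
def First {α : Type} (ix : α → ℕ) (P : α → Prop) (n : ℕ) (x : α) : Prop :=
  n ≤ ix x ∧ P x ∧ ∀ y, n ≤ ix y → ix y < ix x → ¬ P y

theorem exists_first {α : Type} (ix : α → ℕ) (P : α → Prop) (n : ℕ)
    (h : ∃ y, n ≤ ix y ∧ P y) : ∃ a, First ix P n a := by
  obtain ⟨y, hy⟩ := h
  induction hm : ix y using Nat.strong_induction_on generalizing y with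
  | _ m ih =>
    by_cases hex : ∃ z, n ≤ ix z ∧ ix z < ix y ∧ P z
    · obtain ⟨z, h1, h2, h3⟩ := hex
      exact ih _ (by omega) z ⟨h1, h3⟩ rfl
    · push Not at hex
      exact ⟨y, hy.1, hy.2, hex⟩

/-- Correctness of the backwards depth-first traversal (Sipser's technique). -/
theorem dfs_correct {α : Type} [Finite α] (ix : α → ℕ) (hix : Function.Injective ix)
    (R : α → α → Prop) (hR : ∀ a b b', R a b → R a b' → b = b') (u v : α)
    (M : ℕ) (hM : ∀ a, ix a < M)
    (K : Bool → α → Bool → Prop)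
    (h1 : K true u true)
    (h2 : ∀ c x b, c ≠ u → First ix (fun x => x ≠ v ∧ R x c) 0 x → K true x b → K true c b)
    (h3 : ∀ c b, c ≠ u → (∀ x, ¬ (x ≠ v ∧ R x c)) → K false c b → K true c b)
    (h4 : K false v false)
    (h5 : ∀ c p x b, c ≠ v → R c p → First ix (fun x => x ≠ v ∧ R x p) (ix c + 1) x →
      K true x b → K false c b)
    (h6 : ∀ c p b, c ≠ v → R c p → (∀ x, ix c + 1 ≤ ix x → ¬ (x ≠ v ∧ R x p)) →
      K false p b → K false c b) :
    (ReflTransGen R u v → K true v true) ∧ (¬ ReflTransGen R u v → K true v false) := by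
  set Ch : α → α → Prop := fun c x => x ≠ v ∧ R x c with hCh
  have hpath : ∀ w, ReflTransGen R w v ↔ ReflTransGen Ch v w := by
    intro w
    constructor
    · intro h
      induction h using ReflTransGen.head_induction_on with
      | refl => exact .refl
      | @head a c hac _ ih =>
        by_cases hav : a = v
        · rw [hav]
        · exact ih.tail ⟨hav, hac⟩
    · intro h
      induction h with
      | refl => exact .refl
      | tail _ hbc ih => exact ih.head hbc.2
  have hacyc : ∀ c, ReflTransGen Ch v c → ¬ TransGen Ch c c := by
    intro c hc
    induction hc with
    | refl =>
      intro h
      obtain ⟨y, _, hy⟩ := TransGen.tail'_iff.1 h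
      exact hy.1 rfl
    | @tail c' c _ hcc ih =>
      intro h
      obtain ⟨y, hcy, hy⟩ := TransGen.tail'_iff.1 h
      have : y = c' := hR _ _ _ hy.2 hcc.2
      subst this
      exact ih (TransGen.head' hcc hcy)
  -- well-foundedness of the child relation below `v`
  let D := {c : α // ReflTransGen Ch v c}
  have hwf : WellFounded (fun x c : D => TransGen Ch c.1 x.1) := by
    have : IsTrans D (fun x c : D => TransGen Ch c.1 x.1) := ⟨fun _ _ _ h h' => h'.trans h⟩
    have : Std.Irrefl (fun x c : D => TransGen Ch c.1 x.1) := ⟨fun c h => hacyc c.1 c.2 h⟩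
    exact Finite.wellFounded_of_trans_of_irrefl _
  have main : ∀ c : D, (ReflTransGen Ch c.1 u → K true c.1 true) ∧
      (¬ ReflTransGen Ch c.1 u → ∀ b, K false c.1 b → K true c.1 b) := by
    intro c
    induction c using hwf.induction with
    | _ c ihc =>
    obtain ⟨c, hc⟩ := c
    simp only at ihc ⊢
    have ihA : ∀ x, Ch c x → (ReflTransGen Ch x u → K true x true) ∧
      (¬ ReflTransGen Ch x u → ∀ b, K false x b → K true x b) := fun x hx =>
        ihc ⟨x, hc.tail hx⟩ (TransGen.single hx)
    have B : ∀ n x, M - ix x = n → Ch c x →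
        ((∃ x', Ch c x' ∧ ix x ≤ ix x' ∧ ReflTransGen Ch x' u) → K true x true) ∧
        ((¬ ∃ x', Ch c x' ∧ ix x ≤ ix x' ∧ ReflTransGen Ch x' u) →
          ∀ b, K false c b → K true x b) := by
      intro n
      induction n using Nat.strong_induction_on with
      | _ n ihn =>
      intro x hn hx
      have hMx := hM x
      by_cases hxu : ReflTransGen Ch x u
      · exact ⟨fun _ => (ihA x hx).1 hxu, fun h => absurd ⟨x, hx, le_rfl, hxu⟩ h⟩
      · have hgo := (ihA x hx).2 hxu
        by_cases hsib : ∃ y, ix x + 1 ≤ ix y ∧ Ch c y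
        · obtain ⟨y, hy⟩ := exists_first ix _ _ hsib
          obtain ⟨i1, i2⟩ := ihn (M - ix y) (by have := hy.1; omega) y rfl hy.2.1
          have hequiv : (∃ x', Ch c x' ∧ ix x ≤ ix x' ∧ ReflTransGen Ch x' u) →
              (∃ x', Ch c x' ∧ ix y ≤ ix x' ∧ ReflTransGen Ch x' u) := by
            rintro ⟨x', e1, e2, e3⟩
            refine ⟨x', e1, ?_, e3⟩
            by_contra hlt
            refine hy.2.2 x' ?_ (by omega) e1
            have : ix x ≠ ix x' := fun h => hxu (hix h ▸ e3)
            omega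
          constructor
          · intro h
            exact hgo _ (h5 x c y _ hx.1 hx.2 hy (i1 (hequiv h)))
          · intro h b hb
            refine hgo _ (h5 x c y _ hx.1 hx.2 hy (i2 ?_ b hb))
            rintro ⟨x', e1, e2, e3⟩
            exact h ⟨x', e1, by have := hy.1; omega, e3⟩
        · push Not at hsib
          constructor
          · rintro ⟨x', e1, e2, e3⟩
            have : ix x ≠ ix x' := fun h => hxu (hix h ▸ e3)
            exact absurd e1 (hsib x' (by omega))
          · intro _ b hb
            exact hgo _ (h6 x c b hx.1 hx.2 hsib hb)
    by_cases hcu : c = u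
    · subst hcu
      exact ⟨fun _ => h1, fun h => absurd .refl h⟩
    · by_cases hch : ∃ y, 0 ≤ ix y ∧ Ch c y
      · obtain ⟨x, hx⟩ := exists_first ix _ _ hch
        obtain ⟨b1, b2⟩ := B _ x rfl hx.2.1
        constructor
        · intro h
          refine h2 c x _ hcu hx (b1 ?_)
          rcases h.cases_head with h | ⟨x', hx', h'⟩
          · exact absurd h hcu
          · refine ⟨x', hx', ?_, h'⟩
            by_contra hlt
            exact hx.2.2 x' (Nat.zero_le _) (by omega) hx'
        · intro h b hb
          refine h2 c x _ hcu hx (b2 ?_ b hb)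
          rintro ⟨x', e1, _, e3⟩
          exact h (e3.head e1)
      · push Not at hch
        constructor
        · intro h
          rcases h.cases_head with h | ⟨x', hx', h'⟩
          · exact absurd h hcu
          · exact absurd hx' (hch x' (Nat.zero_le _))
        · intro _ b hb
          exact h3 c b hcu (fun x => hch x (Nat.zero_le _)) hb
  obtain ⟨m1, m2⟩ := main ⟨v, .refl⟩
  rw [hpath]
  exact ⟨m1, fun h => m2 h _ h4⟩

end DFS

section Eval

variable {Sig : Type} {rank : Sig → ℕ} {k : ℕ} [NeZero k] [Fintype Sig]

/-- `F` evaluates `φ` under pebble environment `ρ` and depth `d`. -/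
def Evals (φ : TForm Sig rank k) (ρ : ℕ → ℕ) (d : ℕ) (F : Frag Sig k Bool) : Prop :=
  ∀ (t : RTree Sig rank) (ν : ℕ → Pos t) (π : List (ℕ × Pos t)), Inv ρ d ν π →
    Dec F t (roots t k, π) (Sat t φ ν) (roots t k, π)

section TC

variable (F : (ℕ → ℕ) → ℕ → Frag Sig k Bool) (rank) (xs ys us vs : Fin k → ℕ) (ρ : ℕ → ℕ)

noncomputable def childTest (b : ℕ) : Frag Sig k Bool :=
  Frag.ite (eqT fun i => ρ (vs i)) (Frag.ret false)
    (evalAt rank (b + k) (F (updVec (updVec ρ xs fun i => b + k + i.1) ys fun i => b + i.1)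
      (b + k + k)))

noncomputable def parentTest (b : ℕ) : Frag Sig k Bool :=
  evalAt rank (b + k) (F (updVec (updVec ρ xs fun i => b + i.1) ys fun i => b + k + i.1)
      (b + k + k))

noncomputable def enterBody (d : ℕ) : Frag Sig k (Bool ⊕ Bool) :=
  Frag.ite (eqT fun i => ρ (us i))
    ((toRoots rank k).seq (Frag.ret (Sum.inr true)))
    ((dropAll d).seq ((toRoots rank k).seq
      (Frag.ite (search rank (childTest rank F xs ys vs ρ d))
        ((retrAll d).seq (Frag.ret (Sum.inl true)))
        ((goTo rank fun i => d + i.1).seq ((retrAll d).seq (Frag.ret (Sum.inl false)))))))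

noncomputable def ascend (d : ℕ) : Frag Sig k (Bool ⊕ Bool) :=
  (goTo rank fun i => d + k + i.1).seq ((retrAll (d + k)).seq
    ((retrAll d).seq (Frag.ret (Sum.inl false))))

noncomputable def leaveBody (d : ℕ) : Frag Sig k (Bool ⊕ Bool) :=
  Frag.ite (eqT fun i => ρ (vs i))
    ((toRoots rank k).seq (Frag.ret (Sum.inr false)))
    ((dropAll d).seq ((toRoots rank k).seq ((search rank (parentTest rank F xs ys ρ d)).seq
      ((dropAll (d + k)).seq ((goTo rank fun i => d + i.1).seq
        (Frag.ite (nextT rank k)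
          (Frag.ite (search rank (childTest rank F xs ys vs ρ (d + k)))
            ((retrAll (d + k)).seq ((retrAll d).seq (Frag.ret (Sum.inl true))))
            (ascend rank d))
          (ascend rank d)))))))

noncomputable def tcLoop (d : ℕ) (m : Bool) : Frag Sig k Bool :=
  Frag.iter (fun m => cond m (enterBody rank F xs ys us vs ρ d) (leaveBody rank F xs ys vs ρ d)) m

end TC

theorem childTest_spec {φ : TForm Sig rank k} {F : (ℕ → ℕ) → ℕ → Frag Sig k Bool}
    (hF : ∀ ρ d, Evals φ ρ d (F ρ d)) (xs ys vs : Fin k → ℕ) (ρ : ℕ → ℕ) (b : ℕ)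
    (t : RTree Sig rank) (ν : ℕ → Pos t) (π : List (ℕ × Pos t)) (h : Inv ρ b ν π)
    (p x : Fin k → Pos t) :
    Dec (childTest rank F xs ys vs ρ b) t (x, push b p π)
      (x ≠ (fun i => ν (vs i)) ∧ Sat t φ (updVec (updVec ν xs x) ys p)) (x, push b p π) := by
  have hp := h.push p
  have hx := hp.push x
  refine Dec.ite (eqT_spec t _ _ _ hp.1 (fun i => ν (vs i)) (fun i => hp.2 _) x) ?_ ?_
  · intro e
    exact Dec.ret_false fun h => h.1 e
  · intro hne
    refine Dec.congr (P := Sat t φ (updVec (updVec ν xs x) ys p)) ?_ (by simp [hne])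
    refine evalAt_spec t _ _ _ hp.1 x _ (hF _ _ t _ _ ?_)
    exact (hx.updVec xs _ x (push_mem_self _ _ _)).updVec ys _ p
      fun i => push_mem_of _ _ (push_mem_self _ _ _ i)

theorem parentTest_spec {φ : TForm Sig rank k} {F : (ℕ → ℕ) → ℕ → Frag Sig k Bool}
    (hF : ∀ ρ d, Evals φ ρ d (F ρ d)) (xs ys : Fin k → ℕ) (ρ : ℕ → ℕ) (b : ℕ)
    (t : RTree Sig rank) (ν : ℕ → Pos t) (π : List (ℕ × Pos t)) (h : Inv ρ b ν π)
    (c y : Fin k → Pos t) :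
    Dec (parentTest rank F xs ys ρ b) t (y, push b c π)
      (Sat t φ (updVec (updVec ν xs c) ys y)) (y, push b c π) := by
  have hp := h.push c
  have hx := hp.push y
  refine evalAt_spec t _ _ _ hp.1 y _ (hF _ _ t _ _ ?_)
  exact (hx.updVec xs _ c fun i => push_mem_of _ _ (push_mem_self _ _ _ i)).updVec ys _ y
      (push_mem_self _ _ _)

theorem ascend_spec (ρ : ℕ → ℕ) (d : ℕ)
    (t : RTree Sig rank) (ν : ℕ → Pos t) (π : List (ℕ × Pos t)) (h : Inv ρ d ν π)
    (c p y : Fin k → Pos t) :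
    Runs (ascend rank d) t (y, push (d + k) p (push d c π)) (Sum.inl false) (p, π) :=
  (goTo_spec t _ _ _ ((h.push c).push p).1 p (push_mem_self _ _ _) y).seq
    ((retrAll_spec t _ _ _ _).seq ((retrAll_spec t _ _ _ _).seq Runs.ret))

theorem tc_exists {φ : TForm Sig rank k} (xs ys us vs : Fin k → ℕ) (hfun : FunctionalIn φ xs ys)
    (ih : ∀ ρ d, ∃ F, Evals φ ρ d F) (ρ : ℕ → ℕ) (d : ℕ) :
    ∃ F, Evals (TForm.tc xs ys φ us vs) ρ d F := by
  choose F hF using ih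
  refine ⟨(goTo rank fun i => ρ (vs i)).seq (tcLoop rank F xs ys us vs ρ d true), ?_⟩
  intro t ν π h
  have : Finite (Fin k → Pos t) := finite_tuples t
  refine Dec.seq (goTo_spec t _ d π h.1 (fun i => ν (vs i)) (fun i => h.2 _) _) ?_
  have hu := eqT_spec t (fun i => ρ (us i)) d π h.1 (fun i => ν (us i)) (fun i => h.2 _)
  have hv := eqT_spec t (fun i => ρ (vs i)) d π h.1 (fun i => ν (vs i)) (fun i => h.2 _)
  have hleave : ∀ c p, c ≠ (fun i => ν (vs i)) → Sat t φ (updVec (updVec ν xs c) ys p) →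
      ∀ e s', Runs (Frag.ite (nextT rank k)
          (Frag.ite (search rank (childTest rank F xs ys vs ρ (d + k)))
            ((retrAll (d + k)).seq ((retrAll d).seq (Frag.ret (Sum.inl true))))
            (ascend rank d))
          (ascend rank d)) t (c, push (d + k) p (push d c π)) e s' →
        Runs (leaveBody rank F xs ys vs ρ d) t (c, π) e s' := by
    intro c p hc hp e s' hr
    have hs : Runs (search rank (parentTest rank F xs ys ρ d)) t (roots t k, push d c π) true
        (p, push d c π) := by
      refine search_true t _ (parentTest_spec hF xs ys ρ d t ν π h c) p _ hp ?_ ?_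
      · rw [ix_roots]; omega
      · intro y _ hlt hy
        have := hfun t ν c y p hy hp
        rw [this] at hlt
        omega
    exact Runs.ite_false ((hv c).2 hc) ((dropAll_spec t d c π h.1).seq ((toRoots_spec t _ c).seq
      (hs.seq ((dropAll_spec t _ p _ (h.push c).1).seq ((goTo_spec t _ _ _ ((h.push c).push p).1 c
        (fun i => push_mem_of _ _ (push_mem_self _ _ _ i)) p).seq hr)))))
  refine dfs_correct (ix t) (ix_inj t) (fun a b => Sat t φ (updVec (updVec ν xs a) ys b))
    (fun a b b' => hfun t ν a b b') (fun i => ν (us i)) (fun i => ν (vs i)) _ (ix_lt t)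
    (fun m c b => Runs (tcLoop rank F xs ys us vs ρ d m) t (c, π) b (roots t k, π))
    ?_ ?_ ?_ ?_ ?_ ?_
  · exact Runs.iter_exit (Runs.ite_true ((hu _).1 rfl) ((toRoots_spec t _ _).seq Runs.ret))
  · intro c x b hc hx hr
    refine Runs.iter_step (a' := true) ?_ hr
    refine Runs.ite_false ((hu _).2 hc) ((dropAll_spec t d c π h.1).seq ((toRoots_spec t _ c).seq
      (Runs.ite_true (search_true t _ (childTest_spec hF xs ys vs ρ d t ν π h c) x _ hx.2.1 ?_ ?_)
      ((retrAll_spec t _ _ _ _).seq Runs.ret))))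
    · rw [ix_roots]; omega
    · intro y _
      exact hx.2.2 y (Nat.zero_le _)
  · intro c b hc hx hr
    refine Runs.iter_step (a' := false) ?_ hr
    exact Runs.ite_false ((hu _).2 hc) ((dropAll_spec t d c π h.1).seq ((toRoots_spec t _ c).seq
      (Runs.ite_false (search_false t _ (childTest_spec hF xs ys vs ρ d t ν π h c) _
        fun y _ => hx y)
      ((goTo_spec t _ _ _ (h.push c).1 c (push_mem_self _ _ _) _).seq
        ((retrAll_spec t _ _ _ _).seq Runs.ret)))))
  · exact Runs.iter_exit (Runs.ite_true ((hv _).1 rfl) ((toRoots_spec t _ _).seq Runs.ret))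
  · intro c p x b hc hp hx hr
    refine Runs.iter_step (a' := true) ?_ hr
    apply hleave c p hc hp
    rcases nextT_spec t (push (d + k) p (push d c π)) c with ⟨c', e1, e2⟩ | ⟨e1, e2⟩
    · refine Runs.ite_true e2 (Runs.ite_true (search_true t _
        (childTest_spec hF xs ys vs ρ (d + k) t ν _ (h.push c) p) x _ hx.2.1 ?_ ?_)
        ((retrAll_spec t _ _ _ _).seq ((retrAll_spec t _ _ _ _).seq Runs.ret)))
      · rw [e1]; exact hx.1
      · rw [e1]; exact hx.2.2
    · have := e1 x
      have := hx.1
      omega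
  · intro c p b hc hp hx hr
    refine Runs.iter_step (a' := false) ?_ hr
    apply hleave c p hc hp
    rcases nextT_spec t (push (d + k) p (push d c π)) c with ⟨c', e1, e2⟩ | ⟨e1, e2⟩
    · refine Runs.ite_true e2 (Runs.ite_false (search_false t _
        (childTest_spec hF xs ys vs ρ (d + k) t ν _ (h.push c) p) _ ?_)
        (ascend_spec ρ d t ν π h c p _))
      rw [e1]; exact hx
    · exact Runs.ite_false e2 (ascend_spec ρ d t ν π h c p _)

/-- Evaluate an atomic test at the node of variable `x`. -/
noncomputable def atVar (rank : Sig → ℕ) (ρ : ℕ → ℕ) (x : ℕ) (F : Frag Sig k Bool) :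
    Frag Sig k Bool :=
  (goTo rank fun _ => ρ x).seq (Frag.fin' F (toRoots rank k))

theorem atVar_spec {ρ : ℕ → ℕ} {d : ℕ} {t : RTree Sig rank} {ν : ℕ → Pos t}
    {π : List (ℕ × Pos t)} (h : Inv ρ d ν π) (x : ℕ) (F : Frag Sig k Bool) (P : Prop)
    (hF : ∃ hs', Dec F t (fun _ => ν x, π) P (hs', π)) :
    Dec (atVar rank ρ x F) t (roots t k, π) P (roots t k, π) := by
  obtain ⟨hs', hF⟩ := hF
  exact Dec.seq (goTo_spec t _ d π h.1 (fun _ => ν x) (fun i => h.2 _) _)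
    (hF.fin' (toRoots_spec t π _))

theorem Inv.mem_iff {ρ : ℕ → ℕ} {d : ℕ} {t : RTree Sig rank} {ν : ℕ → Pos t}
    {π : List (ℕ × Pos t)} (h : Inv ρ d ν π) (x : ℕ) (w : Pos t) : (ρ x, w) ∈ π ↔ w = ν x :=
  ⟨fun hw => h.1.2 _ _ _ hw (h.2 x), fun e => e ▸ h.2 x⟩

/-- Walk up with head `0` looking for pebble `r`. -/
def ancLoop (r : ℕ) : Frag Sig k Bool :=
  Frag.iter (A := Unit) (fun _ => Frag.ite (Frag.tst (.peb 0 r)) (Frag.ret (Sum.inr true))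
    (Frag.ite (Frag.tst (.chno 0 0)) (Frag.ret (Sum.inr false))
      ((Frag.ins (.up 0)).seq (Frag.ret (Sum.inl ()))))) ()

theorem ancLoop_spec {ρ : ℕ → ℕ} {d : ℕ} {t : RTree Sig rank} {ν : ℕ → Pos t}
    {π : List (ℕ × Pos t)} (h : Inv ρ d ν π) (x : ℕ) (p : List ℕ) :
    ∀ hs : Fin k → Pos t, (hs 0).1 = p →
      ∃ hs', Dec (ancLoop (ρ x)) t (hs, π) ((ν x).1 <+: p) (hs', π) := by
  induction p using List.reverseRecOn with
  | nil =>
    intro hs hp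
    by_cases he : hs 0 = ν x
    · refine ⟨hs, fun _ => ?_, fun hn => absurd ?_ hn⟩
      · exact Runs.iter_exit (Runs.ite_true (Dec.tst.1 ((h.mem_iff x _).2 he)) Runs.ret)
      · rw [← he, hp]
    · refine ⟨hs, fun hpre => absurd ?_ he, fun _ => ?_⟩
      · apply Pos.ext'
        rw [hp, List.prefix_nil.1 hpre]
      · refine Runs.iter_exit (Runs.ite_false (Dec.tst.2 fun hm => he ((h.mem_iff x _).1 hm))
          (Runs.ite_true (Dec.tst.1 ?_) Runs.ret))
        simp [testHolds, hp, childNo_nil]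
  | append_singleton q j ih =>
    intro hs hp
    by_cases he : hs 0 = ν x
    · refine ⟨hs, fun _ => ?_, fun hn => absurd ?_ hn⟩
      · exact Runs.iter_exit (Runs.ite_true (Dec.tst.1 ((h.mem_iff x _).2 he)) Runs.ret)
      · rw [← he, hp]
    · have hpos : IsPos t (q ++ [j]) := hp ▸ (hs 0).2
      obtain ⟨qp, hqp⟩ : ∃ qp : Pos t, qp.1 = q := ⟨⟨q, isPos_of_append hpos⟩, rfl⟩
      have hup := run_up t 0 j hs π qp (by rw [hqp, hp])
      obtain ⟨hs', hd⟩ := ih (Function.update hs 0 qp) (by simp [hqp])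
      have hiff : (ν x).1 <+: q ++ [j] ↔ (ν x).1 <+: q := by
        constructor
        · intro hpre
          rcases List.prefix_concat_iff.1 hpre with e | e
          · exact absurd (Pos.ext' (by rw [hp, e])) he
          · exact e
        · intro hpre
          exact hpre.trans (List.prefix_append _ _)
      have hstep : ∀ b s', Runs (ancLoop (ρ x)) t (Function.update hs 0 qp, π) b s' →
          Runs (ancLoop (ρ x)) t (hs, π) b s' := by
        intro b s' hr
        refine Runs.iter_step (a' := ()) ?_ hr
        refine Runs.ite_false (Dec.tst.2 fun hm => he ((h.mem_iff x _).1 hm))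
          (Runs.ite_false (Dec.tst.2 ?_) (hup.seq Runs.ret))
        simp [testHolds, hp, childNo_snoc]
      refine ⟨hs', ?_⟩
      rw [hiff]
      exact ⟨fun hP => hstep _ _ (hd.1 hP), fun hP => hstep _ _ (hd.2 hP)⟩

theorem ex_exists {φ : TForm Sig rank k} (x : ℕ)
    (ih : ∀ ρ d, ∃ F, Evals φ ρ d F) (ρ : ℕ → ℕ) (d : ℕ) :
    ∃ F, Evals (TForm.ex x φ) ρ d F := by
  obtain ⟨F, hF⟩ := ih (Function.update ρ x (d + (0 : Fin k).1)) (d + k)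
  refine ⟨Frag.fin' (search rank (evalAt rank d F)) (toRoots rank k), ?_⟩
  intro t ν π h
  have hT : ∀ a, Dec (evalAt rank d F) t (a, π) (Sat t φ (Function.update ν x (a 0))) (a, π) :=
    fun a => evalAt_spec t d F π h.1 a _ (hF t _ _ ((h.push a).update x _ _ (push_mem_self _ _ _ 0)))
  constructor
  · rintro ⟨u, hu⟩
    obtain ⟨a, h1, h2, h3⟩ := exists_first (ix t)
      (fun a : Fin k → Pos t => Sat t φ (Function.update ν x (a 0))) 0
      ⟨fun _ => u, Nat.zero_le _, hu⟩
    refine (search_true t π hT a _ h2 ?_ ?_).fin' (toRoots_spec t π _)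
    · rw [ix_roots]; omega
    · intro y _
      exact h3 y (Nat.zero_le _)
  · intro hn
    refine (search_false t π hT _ ?_).fin' (toRoots_spec t π _)
    intro y _ hy
    exact hn ⟨y 0, hy⟩

theorem not_exists {φ : TForm Sig rank k}
    (ih : ∀ ρ d, ∃ F, Evals φ ρ d F) (ρ : ℕ → ℕ) (d : ℕ) :
    ∃ F, Evals (TForm.not φ) ρ d F := by
  obtain ⟨F, hF⟩ := ih ρ d
  refine ⟨Frag.ite F (Frag.ret false) (Frag.ret true), fun t ν π h => ?_⟩
  exact Dec.ite (hF t ν π h) (fun hp => Dec.ret_false (not_not.2 hp)) (fun hp => Dec.ret_true hp)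

theorem eval_exists (φ : TForm Sig rank k) (hdet : DetTC φ) :
    ∀ ρ d, ∃ F, Evals φ ρ d F := by
  induction φ with
  | lab a x =>
    intro ρ d
    refine ⟨atVar rank ρ x (Frag.tst (.lab 0 a)), fun t ν π h => ?_⟩
    exact atVar_spec h x _ _ ⟨_, Dec.tst⟩
  | edg i x y =>
    intro ρ d
    refine ⟨atVar rank ρ y (Nat.casesOn i (Frag.ret false) fun i =>
      Frag.ite (Frag.tst (.chno 0 (i + 1)))
        ((Frag.ins (.up 0)).seq (Frag.tst (.peb 0 (ρ x)))) (Frag.ret false)), fun t ν π h => ?_⟩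
    refine atVar_spec h y _ _ ?_
    cases i with
    | zero => exact ⟨_, Dec.ret_false fun h => by simpa using h.1⟩
    | succ i =>
      by_cases hc : childNo (ν y).1 = i + 1
      · obtain ⟨q, hq⟩ : ∃ q, (ν y).1 = q ++ [i] := by
          rcases List.eq_nil_or_concat (ν y).1 with e | ⟨q, j, e⟩
          · rw [e, childNo_nil] at hc; omega
          · rw [List.concat_eq_append] at e
            rw [e, childNo_snoc] at hc
            obtain rfl : j = i := by omega
            exact ⟨q, e⟩
        obtain ⟨qp, hqp⟩ : ∃ qp : Pos t, qp.1 = q :=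
          ⟨⟨q, isPos_of_append (hq ▸ (ν y).2)⟩, rfl⟩
        have hup := run_up t (0 : Fin k) i (fun _ => ν y) π qp (by rw [hqp, hq])
        refine ⟨_, Dec.ite Dec.tst (fun _ => Dec.seq hup (Dec.tst.congr ?_))
          (fun hn => absurd hc hn)⟩
        simp only [testHolds, Function.update_self]
        rw [h.mem_iff x]
        simp only [Sat, hq, Nat.add_sub_cancel]
        constructor
        · intro e
          exact ⟨by omega, by rw [← e, hqp]⟩
        · rintro ⟨_, e⟩
          apply Pos.ext'
          rw [hqp]
          exact List.append_cancel_right e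
      · refine ⟨_, Dec.ite Dec.tst (fun hp => absurd hp hc) (fun _ => Dec.ret_false ?_)⟩
        rintro ⟨_, e⟩
        apply hc
        rw [e, childNo_snoc]
        simp
  | le x y =>
    intro ρ d
    refine ⟨atVar rank ρ y (ancLoop (ρ x)), fun t ν π h => ?_⟩
    exact atVar_spec h y _ _ (ancLoop_spec h x _ _ rfl)
  | eq x y =>
    intro ρ d
    refine ⟨atVar rank ρ x (Frag.tst (.peb 0 (ρ y))), fun t ν π h => ?_⟩
    exact atVar_spec h x _ _ ⟨_, Dec.tst.congr (h.mem_iff y _)⟩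
  | not φ ih => exact not_exists (ih hdet)
  | and φ ψ ih1 ih2 =>
    intro ρ d
    obtain ⟨F, hF⟩ := ih1 hdet.1 ρ d
    obtain ⟨G, hG⟩ := ih2 hdet.2 ρ d
    refine ⟨Frag.ite F G (Frag.ret false), fun t ν π h => ?_⟩
    exact Dec.ite (hF t ν π h) (fun hp => (hG t ν π h).congr ⟨fun h => ⟨hp, h⟩, fun h => h.2⟩)
      (fun hp => Dec.ret_false fun h => hp h.1)
  | or φ ψ ih1 ih2 =>
    intro ρ d
    obtain ⟨F, hF⟩ := ih1 hdet.1 ρ d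
    obtain ⟨G, hG⟩ := ih2 hdet.2 ρ d
    refine ⟨Frag.ite F (Frag.ret true) G, fun t ν π h => ?_⟩
    exact Dec.ite (hF t ν π h) (fun hp => Dec.ret_true (Or.inl hp))
      (fun hp => (hG t ν π h).congr ⟨fun h => Or.inr h, fun h => h.resolve_left hp⟩)
  | ex x φ ih => exact ex_exists x (ih hdet)
  | all x φ ih =>
    intro ρ d
    obtain ⟨F, hF⟩ := not_exists (ex_exists x (not_exists (ih hdet))) ρ d
    refine ⟨F, fun t ν π h => (hF t ν π h).congr ?_⟩
    simp [Sat]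
  | tc xs ys φ us vs ih => exact tc_exists xs ys us vs hdet.1 (ih hdet.2)

end Eval

section Final

variable {Sig : Type} {rank : Sig → ℕ} {k : ℕ}

def TTest.mapP {X Y : Type} (g : X → Y) : TTest Sig k X → TTest Sig k Y
  | .lab i a => .lab i a
  | .peb i x => .peb i (g x)
  | .chno i j => .chno i j

def TInstr.mapP {X Y : Type} (g : X → Y) : TInstr Sig k X → TInstr Sig k Y
  | .up i => .up i
  | .down i j => .down i j
  | .dropPeb i x => .dropPeb i (g x)
  | .retrieve x => .retrieve (g x)
  | .test b τ => .test b (τ.mapP g)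

def TTest.bnd : TTest Sig k ℕ → ℕ
  | .peb _ x => x
  | _ => 0

def TInstr.bnd : TInstr Sig k ℕ → ℕ
  | .dropPeb _ x => x
  | .retrieve x => x
  | .test _ τ => τ.bnd
  | _ => 0

def Node.bnd {B : Type} : Node Sig k B → ℕ
  | .act ins _ => ins.bnd
  | .br τ _ _ => τ.bnd

/-- The instructions realising a control node. -/
def Node.instrs {B : Type} : Node Sig k B → Set (TInstr Sig k ℕ × B)
  | .act ins n => {(ins, n)}
  | .br τ y n => {(.test true τ, y), (.test false τ, n)}

theorem Node.instrs_finite {B : Type} (N : Node Sig k B) : N.instrs.Finite := by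
  cases N <;> simp [Node.instrs]

/-- Pebble stacks over `Fin (M+1)` read as stacks over `ℕ`. -/
def stk {t : RTree Sig rank} {M : ℕ} (π : List (Fin (M + 1) × Pos t)) : List (ℕ × Pos t) :=
  π.map fun p => (p.1.val, p.2)

theorem mem_stk {t : RTree Sig rank} {M : ℕ} {π : List (Fin (M + 1) × Pos t)} {x : ℕ} {w : Pos t}
    (hx : x ≤ M) : (x, w) ∈ stk π ↔ (Fin.ofNat (M + 1) x, w) ∈ π := by
  have hval : (Fin.ofNat (M + 1) x).val = x := Nat.mod_eq_of_lt (by omega)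
  simp only [stk, List.mem_map, Prod.mk.injEq]
  constructor
  · rintro ⟨⟨a, b⟩, h, h1, h2⟩
    obtain rfl : a = Fin.ofNat (M + 1) x := Fin.ext (by rw [hval]; exact h1)
    obtain rfl : b = w := h2
    exact h
  · intro h
    exact ⟨_, h, hval, rfl⟩

theorem testHolds_mapP {t : RTree Sig rank} {M : ℕ} {τ : TTest Sig k ℕ} (hb : τ.bnd ≤ M)
    (hs : Fin k → Pos t) (π : List (Fin (M + 1) × Pos t)) :
    testHolds t (τ.mapP (Fin.ofNat (M + 1))) hs π ↔ testHolds t τ hs (stk π) := by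
  cases τ with
  | lab i a => exact Iff.rfl
  | peb i x => exact (mem_stk hb).symm
  | chno i j => exact Iff.rfl

theorem instrStep_mapP {t : RTree Sig rank} {M : ℕ} {ins : TInstr Sig k ℕ} (hb : ins.bnd ≤ M)
    {hs hs' : Fin k → Pos t} {π : List (Fin (M + 1) × Pos t)} {ρ : List (ℕ × Pos t)}
    (h : instrStep t ins hs (stk π) hs' ρ) :
    ∃ π', ρ = stk π' ∧ instrStep t (ins.mapP (Fin.ofNat (M + 1))) hs π hs' π' := by
  cases ins with
  | up i => exact ⟨π, h.1, rfl, h.2⟩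
  | down i j => exact ⟨π, h.1, rfl, h.2⟩
  | dropPeb i x =>
    have hval : (Fin.ofNat (M + 1) x).val = x := Nat.mod_eq_of_lt (Nat.lt_succ_of_le hb)
    obtain ⟨h1, h2, h3⟩ := h
    refine ⟨(Fin.ofNat (M + 1) x, hs i) :: π, ?_, h1, rfl, fun w hw => h3 w ((mem_stk hb).2 hw)⟩
    rw [h2]
    simp only [stk, List.map_cons, hval]
  | retrieve x =>
    obtain ⟨h1, w, h2⟩ := h
    cases π with
    | nil => simp [stk] at h2
    | cons p π =>
      obtain ⟨a, b⟩ := p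
      simp only [stk, List.map_cons, List.cons.injEq, Prod.mk.injEq] at h2
      obtain ⟨⟨h3, h4⟩, h5⟩ := h2
      have hval : (Fin.ofNat (M + 1) x).val = x := Nat.mod_eq_of_lt (Nat.lt_succ_of_le hb)
      obtain rfl : a = Fin.ofNat (M + 1) x := Fin.ext (by rw [hval]; exact h3)
      exact ⟨π, h5.symm, h1, b, rfl⟩
  | test b τ =>
    obtain ⟨h1, h2, h3⟩ := h
    exact ⟨π, h2, h1, rfl, (testHolds_mapP hb hs π).trans h3⟩

/-- The automaton of a fragment. -/
noncomputable def Frag.toTWA (rank : Sig → ℕ) (G : Frag Sig k Bool) (M : ℕ) : TWA Sig rank k where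
  Q := G.Q ⊕ Bool
  finQ := by
    have := G.fin
    exact Fintype.ofFinite _
  X := Fin (M + 1)
  finX := inferInstance
  q0 := Sum.inl G.q0
  acc := {Sum.inr true}
  instr := ⋃ q : G.Q,
    Set.image (fun p => (Sum.inl q, p.1.mapP (Fin.ofNat (M + 1)), p.2)) (G.δ q).instrs
  instrFin := by
    have := G.fin
    exact Set.finite_iUnion fun q => (Node.instrs_finite _).image _

theorem toTWA_mem {G : Frag Sig k Bool} {M : ℕ} {p q : G.Q ⊕ Bool} {χ : TInstr Sig k (Fin (M + 1))}
    (h : (p, χ, q) ∈ (Frag.toTWA rank G M).instr) :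
    ∃ q0, p = Sum.inl q0 ∧ ∃ ins, (ins, q) ∈ (G.δ q0).instrs ∧
      χ = ins.mapP (Fin.ofNat (M + 1)) := by
  obtain ⟨q0, ⟨a, b⟩, hm, he⟩ := Set.mem_iUnion.1 h
  simp only [Prod.mk.injEq] at he
  obtain ⟨rfl, rfl, rfl⟩ := he
  exact ⟨q0, rfl, a, hm, rfl⟩

theorem toTWA_of {G : Frag Sig k Bool} {M : ℕ} {q0 : G.Q} {q : G.Q ⊕ Bool} {ins : TInstr Sig k ℕ}
    (h : (ins, q) ∈ (G.δ q0).instrs) :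
    ((Sum.inl q0 : G.Q ⊕ Bool), ins.mapP (Fin.ofNat (M + 1)), q) ∈ (Frag.toTWA rank G M).instr :=
  Set.mem_iUnion.2 ⟨q0, (ins, q), h, rfl⟩

theorem toTWA_det (G : Frag Sig k Bool) (M : ℕ) : Deterministic (Frag.toTWA rank G M) := by
  intro p χ₁ q₁ χ₂ q₂ h1 h2 hne
  obtain ⟨q0, rfl, i1, m1, rfl⟩ := toTWA_mem h1
  obtain ⟨q0', he, i2, m2, rfl⟩ := toTWA_mem h2
  obtain rfl : q0 = q0' := Sum.inl.inj he
  cases hN : G.δ q0 with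
  | act ins n =>
    rw [hN] at m1 m2
    simp only [Node.instrs, Set.mem_singleton_iff] at m1 m2
    cases m1
    cases m2
    exact absurd rfl hne
  | br τ y n =>
    rw [hN] at m1 m2
    simp only [Node.instrs, Set.mem_insert_iff, Set.mem_singleton_iff] at m1 m2
    rcases m1 with m1 | m1 <;> rcases m2 with m2 | m2 <;> cases m1 <;> cases m2
    · exact absurd rfl hne
    · exact Or.inl ⟨true, _, rfl, rfl⟩
    · exact Or.inr ⟨true, _, rfl, rfl⟩
    · exact absurd rfl hne

theorem instrStep_unique {t : RTree Sig rank} {X : Type} {ins : TInstr Sig k X}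
    {hs h1 h2 : Fin k → Pos t} {π π1 π2 : List (X × Pos t)}
    (a : instrStep t ins hs π h1 π1) (b : instrStep t ins hs π h2 π2) : h1 = h2 ∧ π1 = π2 := by
  cases ins with
  | up i =>
    obtain ⟨a1, ⟨j, a2⟩, a3⟩ := a
    obtain ⟨b1, ⟨j', b2⟩, b3⟩ := b
    refine ⟨?_, a1.trans b1.symm⟩
    funext h
    by_cases hi : h = i
    · subst hi
      rw [a2] at b2
      exact Subtype.ext (List.append_inj' b2 rfl).1
    · rw [a3 h hi, b3 h hi]
  | down i j =>
    obtain ⟨a1, _, a2, a3⟩ := a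
    obtain ⟨b1, _, b2, b3⟩ := b
    refine ⟨?_, a1.trans b1.symm⟩
    funext h
    by_cases hi : h = i
    · subst hi
      exact Subtype.ext (a2.trans b2.symm)
    · rw [a3 h hi, b3 h hi]
  | dropPeb i x => exact ⟨a.1.trans b.1.symm, a.2.1.trans b.2.1.symm⟩
  | retrieve x =>
    obtain ⟨a1, w, a2⟩ := a
    obtain ⟨b1, w', b2⟩ := b
    rw [a2] at b2
    exact ⟨a1.trans b1.symm, (List.cons.inj b2).2⟩
  | test c τ => exact ⟨a.1.trans b.1.symm, a.2.1.trans b.2.1.symm⟩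

theorem step_unique {A : TWA Sig rank k} (hA : Deterministic A) {t : RTree Sig rank}
    {c c1 c2 : TConf A t} (h1 : Step A t c c1) (h2 : Step A t c c2) : c1 = c2 := by
  obtain ⟨i1, m1, s1⟩ := h1
  obtain ⟨i2, m2, s2⟩ := h2
  have neg : ∀ (χ χ' : TInstr Sig k A.X) (d d' : TConf A t), negOf χ χ' →
      instrStep t χ c.2.1 c.2.2 d.2.1 d.2.2 → instrStep t χ' c.2.1 c.2.2 d'.2.1 d'.2.2 → False := by
    rintro χ χ' d d' ⟨b, τ, rfl, rfl⟩ e1 e2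
    have f1 := e1.2.2
    have f2 := e2.2.2
    cases b <;> simp_all
  by_cases he : (i1, c1.1) = (i2, c2.1)
  · simp only [Prod.mk.injEq] at he
    obtain ⟨rfl, e2⟩ := he
    obtain ⟨e3, e4⟩ := instrStep_unique s1 s2
    exact Prod.ext e2 (Prod.ext e3 e4)
  · rcases hA _ _ _ _ _ m1 m2 he with h | h
    · exact (neg _ _ _ _ h s1 s2).elim
    · exact (neg _ _ _ _ h s2 s1).elim

theorem halt_unique {A : TWA Sig rank k} (hA : Deterministic A) {t : RTree Sig rank}
    {c c1 c2 : TConf A t} (h1 : ReflTransGen (Step A t) c c1) (h2 : ReflTransGen (Step A t) c c2)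
    (f1 : HaltingConf A t c1) (f2 : HaltingConf A t c2) : c1 = c2 := by
  induction h1 using ReflTransGen.head_induction_on with
  | refl =>
    rcases h2.cases_head with h | ⟨d, h, _⟩
    · exact h
    · exact absurd h (f1 d)
  | head hac _ ih =>
    rcases h2.cases_head with h | ⟨d, h, h'⟩
    · subst h
      exact absurd hac (f2 _)
    · rw [step_unique hA hac h] at ih
      exact ih h'

theorem toTWA_halt (G : Frag Sig k Bool) (M : ℕ) (t : RTree Sig rank) (b : Bool)
    (s : (Fin k → Pos t) × List (Fin (M + 1) × Pos t)) :
    HaltingConf (Frag.toTWA rank G M) t ((Sum.inr b : G.Q ⊕ Bool), s) := by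
  rintro c' ⟨ins, hm, _⟩
  obtain ⟨q0, he, _⟩ := toTWA_mem hm
  cases he

theorem toTWA_step {G : Frag Sig k Bool} {M : ℕ} (hM : ∀ q, (G.δ q).bnd ≤ M) {t : RTree Sig rank}
    {q q' : G.Q ⊕ Bool} {hs : Fin k → Pos t} {π : List (Fin (M + 1) × Pos t)} {s' : St t k}
    (h : FStep G t (q, (hs, stk π)) (q', s')) :
    ∃ π', s'.2 = stk π' ∧ Step (Frag.toTWA rank G M) t (q, hs, π) (q', s'.1, π') := by
  cases h with
  | @mk q0 _ _ _ h =>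
    have hb := hM q0
    have hof := fun ins (h : (ins, q') ∈ (G.δ q0).instrs) => toTWA_of (rank := rank) (M := M) h
    generalize G.δ q0 = N at h hb hof
    cases h with
    | act h =>
      obtain ⟨π', e, h'⟩ := instrStep_mapP hb h
      exact ⟨π', e, _, hof _ rfl, h'⟩
    | yes h =>
      exact ⟨π, rfl, _, hof _ (Or.inl rfl), rfl, rfl,
        iff_of_true ((testHolds_mapP hb hs π).2 h) rfl⟩
    | no h =>
      refine ⟨π, rfl, _, hof _ (Or.inr rfl), rfl, rfl, ?_⟩
      exact iff_of_false (fun h' => h ((testHolds_mapP hb hs π).1 h')) (by simp)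

theorem toTWA_runs {G : Frag Sig k Bool} {M : ℕ} (hM : ∀ q, (G.δ q).bnd ≤ M) {t : RTree Sig rank}
    {c c' : (G.Q ⊕ Bool) × St t k} (h : ReflTransGen (FStep G t) c c')
    (π : List (Fin (M + 1) × Pos t)) (hπ : c.2.2 = stk π) :
    ∃ π', c'.2.2 = stk π' ∧
      ReflTransGen (Step (Frag.toTWA rank G M) t) (c.1, c.2.1, π) (c'.1, c'.2.1, π') := by
  induction h with
  | refl => exact ⟨π, hπ, .refl⟩
  | @tail b c' _ hs ih =>
    obtain ⟨π1, e1, r1⟩ := ih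
    obtain ⟨q, hs1, ρ⟩ := b
    obtain rfl : ρ = stk π1 := e1
    obtain ⟨π2, e2, r2⟩ := toTWA_step hM hs
    exact ⟨π2, e2, r1.tail r2⟩

theorem stk_nil {t : RTree Sig rank} {M : ℕ} {π : List (Fin (M + 1) × Pos t)}
    (h : [] = stk π) : π = [] := by
  cases π with
  | nil => rfl
  | cons a l => simp [stk] at h

variable [NeZero k] [Fintype Sig]

/-- The closed formula is decided by a fragment. -/
theorem closed_exists (φ : TForm Sig rank k) (hdet : DetTC φ) : ∃ G : Frag Sig k Bool,
    ∀ t : RTree Sig rank, Dec G t (roots t k, []) (Sat t φ fun _ => rootPos t) (roots t k, []) := by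
  obtain ⟨F, hF⟩ := eval_exists φ hdet (fun _ => 0) 1
  refine ⟨(Frag.ins (.dropPeb 0 0)).seq (Frag.fin' F (Frag.ins (.retrieve 0))), fun t => ?_⟩
  have hinv : Inv (fun _ => 0) 1 (fun _ => rootPos t) [(0, rootPos t)] := by
    refine ⟨⟨fun x w h => ?_, fun x w w' h h' => ?_⟩, fun x => by simp⟩
    · simp only [List.mem_singleton, Prod.mk.injEq] at h
      omega
    · simp only [List.mem_singleton, Prod.mk.injEq] at h h'
      rw [h.2, h'.2]
  refine Dec.seq (s1 := (roots t k, [(0, rootPos t)])) (Runs.ins ⟨rfl, rfl, by simp⟩)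
    (Dec.fin' (hF t _ _ hinv) (Runs.ins ⟨rfl, _, rfl⟩))

end Final

/-- `FO+DTC^k ⊆ DPTWA^k`; moreover the accepting deterministic
automaton can be constructed so that on every input tree it halts with all heads
at the root. -/
theorem FODTC_subset_DPTWA_always_halting (Sig : Type) [Fintype Sig]
    (rank : Sig → ℕ) (k : ℕ) (hk : 1 ≤ k) :
    ∀ L ∈ FODTC Sig rank k, ∃ A : TWA Sig rank k, Deterministic A ∧ L = Lang A ∧
      ∀ t : RTree Sig rank, ∃ c : TConf A t,
        Relation.ReflTransGen (Step A t) (initConf A t) c ∧ HaltingConf A t c ∧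
        c.2.1 = fun _ => rootPos t := by
  have : NeZero k := ⟨by omega⟩
  rintro L ⟨φ, _, hdet, _, rfl⟩
  obtain ⟨G, hG⟩ := closed_exists φ hdet
  obtain ⟨M, hM⟩ : ∃ M, ∀ q, (G.δ q).bnd ≤ M := by
    have := G.fin
    obtain ⟨M, hM⟩ := (Set.finite_range fun q => (G.δ q).bnd).bddAbove
    exact ⟨M, fun q => hM ⟨q, rfl⟩⟩
  have run : ∀ (t : RTree Sig rank) (b : Bool), Runs G t (roots t k, []) b (roots t k, []) →
      ReflTransGen (Step (Frag.toTWA rank G M) t) (initConf _ t)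
        ((Sum.inr b : G.Q ⊕ Bool), (fun _ => rootPos t), []) := by
    intro t b h
    obtain ⟨π', e, r⟩ := toTWA_runs (M := M) hM h [] rfl
    rw [stk_nil e] at r
    exact r
  refine ⟨Frag.toTWA rank G M, toTWA_det G M, ?_, ?_⟩
  · ext t
    constructor
    · intro h
      exact ⟨Sum.inr true, rfl, run t true ((hG t).1 h), toTWA_halt G M t true _⟩
    · rintro ⟨q, hq, hr, hh⟩
      by_contra hn
      have := halt_unique (toTWA_det G M) hr (run t false ((hG t).2 hn)) hh
        (toTWA_halt G M t false _)
      have h1 : q = (Sum.inr false : G.Q ⊕ Bool) := congrArg Prod.fst this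
      have h2 : q = (Sum.inr true : G.Q ⊕ Bool) := hq
      rw [h1] at h2
      cases h2
  · intro t
    by_cases h : Sat t φ fun _ => rootPos t
    · exact ⟨_, run t true ((hG t).1 h), toTWA_halt G M t true _, rfl⟩
    · exact ⟨_, run t false ((hG t).2 h), toTWA_halt G M t false _, rfl⟩

end NestedPebbles
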